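/- arXiv:2304.03426 — 3 statements merged into one kernel-verified Lean document; each statement's English description precedes it below -/
import Mathlib

section
/- Let K = {x ∈ ℝ^n : Ax ≥ b} be a bounded polytope with nonempty interior, where A ∈ ℝ^{m×n} has rows a_1ᵀ,…,a_mᵀ and b ∈ ℝ^m, let vc(K) be its volumetric center, and let Cov(K) be its covariance matrix. Then (1/(4 m³ n²)) · H(vc(K)) ⪯ Cov(K)^{-1} ⪯ 4 n² · H(vc(K)), where M ⪯ N means N − M is positive semidefinite. -/
open Matrix MeasureTheory

/-- The Hessian of the log-barrier of the polytope `{x | A x ≥ b}` at the point `x`: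
`H(x) = ∑ i, aᵢ aᵢᵀ / (aᵢᵀ x - bᵢ)²`. -/
noncomputable def Hmat {m n : ℕ} (A : Matrix (Fin m) (Fin n) ℝ) (b : Fin m → ℝ)
    (x : Fin n → ℝ) : Matrix (Fin n) (Fin n) ℝ :=
  ∑ i, ((A i ⬝ᵥ x - b i) ^ 2)⁻¹ • Matrix.vecMulVec (A i) (A i)

/-- The volumetric function `F(x) = (1/2) ln det H(x)`. -/
noncomputable def Fvol {m n : ℕ} (A : Matrix (Fin m) (Fin n) ℝ) (b : Fin m → ℝ)
    (x : Fin n → ℝ) : ℝ :=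
  (1 / 2) * Real.log (Hmat A b x).det

/-- The centroid of a convex body `K ⊆ ℝⁿ`: `cg(K) = (1/vol(K)) ∫_K x dx`. -/
noncomputable def centroid {n : ℕ} (K : Set (Fin n → ℝ)) : Fin n → ℝ :=
  ((volume K).toReal)⁻¹ • ∫ x in K, x

/-- The covariance matrix of a convex body `K ⊆ ℝⁿ`. -/
noncomputable def covMat {n : ℕ} (K : Set (Fin n → ℝ)) : Matrix (Fin n) (Fin n) ℝ :=
  fun i j => ((volume K).toReal)⁻¹ *
    ∫ x in K, (x i - centroid K i) * (x j - centroid K j)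

open scoped Pointwise

lemma aux_cs {n : ℕ} {P : Matrix (Fin n) (Fin n) ℝ} (hP : P.PosSemidef) (u v : Fin n → ℝ) :
    (u ⬝ᵥ (P *ᵥ v)) ^ 2 ≤ (u ⬝ᵥ (P *ᵥ u)) * (v ⬝ᵥ (P *ᵥ v)) := by
  have hsym : v ⬝ᵥ (P *ᵥ u) = u ⬝ᵥ (P *ᵥ v) := by
    rw [dotProduct_mulVec, ← mulVec_transpose, dotProduct_comm]
    have := hP.isHermitian
    rw [IsHermitian, conjTranspose_eq_transpose_of_trivial] at this
    rw [this]
  have h : ∀ t : ℝ, 0 ≤ (v ⬝ᵥ (P *ᵥ v)) * (t * t) + (2 * (u ⬝ᵥ (P *ᵥ v))) * t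
      + u ⬝ᵥ (P *ᵥ u) := by
    intro t
    have h := hP.dotProduct_mulVec_nonneg (u + t • v)
    simp only [star_trivial, mulVec_add, mulVec_smul, dotProduct_add, add_dotProduct,
      smul_dotProduct, dotProduct_smul, smul_eq_mul, hsym] at h
    linarith
  have := discrim_le_zero h
  rw [discrim] at this
  linarith

lemma aux_cs_inv {n : ℕ} {P : Matrix (Fin n) (Fin n) ℝ} (hP : P.PosDef) (u v : Fin n → ℝ) :
    (u ⬝ᵥ v) ^ 2 ≤ (u ⬝ᵥ (P *ᵥ u)) * (v ⬝ᵥ (P⁻¹ *ᵥ v)) := by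
  have hdet : IsUnit P.det := (Matrix.isUnit_iff_isUnit_det _).1 hP.isUnit
  have := aux_cs hP.posSemidef u (P⁻¹ *ᵥ v)
  rw [mulVec_mulVec, Matrix.mul_nonsing_inv _ hdet, one_mulVec] at this
  rwa [dotProduct_comm (P⁻¹ *ᵥ v)] at this

open scoped MatrixOrder in
lemma aux_trace {n : ℕ} {P Q : Matrix (Fin n) (Fin n) ℝ} (hP : P.PosDef) (hQ : Q.PosDef)
    (h : P.det ≤ Q.det) : (n : ℝ) ≤ (P⁻¹ * Q).trace := by
  obtain ⟨B, hB⟩ := CStarAlgebra.nonneg_iff_eq_star_mul_self.1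
    (nonneg_iff_posSemidef.2 hP.posSemidef)
  rw [star_eq_conjTranspose] at hB
  have hPd := hP.det_pos
  have hd : P.det = B.det * B.det := by
    rw [hB, det_mul, det_conjTranspose]; simp
  have hBd : B.det ≠ 0 := by
    intro h0; rw [hd, h0] at hPd; simp at hPd
  have hBu : IsUnit B.det := isUnit_iff_ne_zero.2 hBd
  set M := (B⁻¹)ᴴ * Q * B⁻¹ with hM
  have hMp : M.PosSemidef := hQ.posSemidef.conjTranspose_mul_mul_same _
  have hdetM : 1 ≤ M.det := by
    rw [hM, det_mul, det_mul, det_conjTranspose, det_nonsing_inv, Ring.inverse_eq_inv', star_trivial]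
    have : (B.det)⁻¹ * Q.det * (B.det)⁻¹ = Q.det / P.det := by
      rw [hd]; field_simp
    rw [this, one_le_div hPd]; exact h
  have htr : (P⁻¹ * Q).trace = M.trace := by
    rw [hM, trace_mul_comm (_ * Q), ← Matrix.mul_assoc]
    congr 2
    rw [hB, Matrix.mul_inv_rev, conjTranspose_nonsing_inv]
  rw [htr, hMp.isHermitian.trace_eq_sum_eigenvalues]
  rw [hMp.isHermitian.det_eq_prod_eigenvalues] at hdetM
  simp only [RCLike.ofReal_real_eq_id, id] at hdetM ⊢
  have hpos : ∀ i, 0 < hMp.isHermitian.eigenvalues i := by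
    intro i
    refine lt_of_le_of_ne (hMp.eigenvalues_nonneg i) fun h0 => ?_
    rw [Finset.prod_eq_zero (Finset.mem_univ i) h0.symm] at hdetM
    linarith
  have hl : 0 ≤ ∑ i, Real.log (hMp.isHermitian.eigenvalues i) := by
    rw [← Real.log_prod (fun i _ => (hpos i).ne')]
    exact Real.log_nonneg hdetM
  have : ∑ i, Real.log (hMp.isHermitian.eigenvalues i)
      ≤ ∑ i, (hMp.isHermitian.eigenvalues i - 1) :=
    Finset.sum_le_sum fun i _ => Real.log_le_sub_one_of_pos (hpos i)
  rw [Finset.sum_sub_distrib] at this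
  simp at this
  linarith

lemma aux_real {m : ℕ} (N : ℝ) (σ w : Fin m → ℝ) (h0 : ∀ i, 0 ≤ σ i) (hs : ∑ i, σ i = N)
    (hsw : ∑ i, σ i * w i = 0) (hw : ∀ i, -1 ≤ w i)
    (hl : ∀ i, w i ^ 2 ≤ σ i * ∑ j, w j ^ 2) :
    ∑ j, w j ^ 2 ≤ 4 * (m : ℝ) ^ 3 * N ^ 2 := by
  rcases Nat.eq_zero_or_pos m with rfl | hm
  · simp
  have hN : 0 ≤ N := hs ▸ Finset.sum_nonneg fun i _ => h0 i
  have : Nonempty (Fin m) := ⟨⟨0, hm⟩⟩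
  obtain ⟨k, hk⟩ := Finite.exists_max (fun i => |w i|)
  have hD : ∑ j, w j ^ 2 ≤ m * |w k| ^ 2 := by
    calc ∑ j, w j ^ 2 ≤ ∑ j : Fin m, |w k| ^ 2 := by
          refine Finset.sum_le_sum fun i _ => ?_
          rw [← sq_abs (w i)]
          exact pow_le_pow_left₀ (abs_nonneg _) (hk i) 2
      _ = _ := by simp
  have h1 : σ k * |w k| ≤ 2 * N := by
    calc σ k * |w k| ≤ ∑ i, σ i * |w i| :=
          Finset.single_le_sum (f := fun i => σ i * |w i|)
            (fun i _ => mul_nonneg (h0 i) (abs_nonneg _)) (Finset.mem_univ k)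
      _ ≤ ∑ i, (σ i * w i + 2 * σ i) := by
          refine Finset.sum_le_sum fun i _ => ?_
          have : |w i| ≤ w i + 2 := abs_le.2 ⟨by linarith [hw i], by linarith⟩
          nlinarith [h0 i]
      _ = 2 * N := by rw [Finset.sum_add_distrib, hsw, ← Finset.mul_sum, hs]; ring
  set M := |w k| with hM
  have hM0 : 0 ≤ M := abs_nonneg _
  have h2 : M ^ 2 ≤ σ k * (m * M ^ 2) := by
    rw [hM, sq_abs]
    refine (hl k).trans ?_
    have := mul_le_mul_of_nonneg_left hD (h0 k)
    rwa [hM, sq_abs] at this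
  have hm1 : (0 : ℝ) ≤ m := by positivity
  have h3 : M ≤ 2 * N * m := by
    rcases hM0.eq_or_lt with h | h
    · rw [← h]; positivity
    have : M * M ≤ M * (2 * N * m) := by
      calc M * M = M ^ 2 := by ring
        _ ≤ σ k * (m * M ^ 2) := h2
        _ = (σ k * M) * (m * M) := by ring
        _ ≤ (2 * N) * (m * M) := by gcongr
        _ = _ := by ring
    exact le_of_mul_le_mul_left this h
  calc ∑ j, w j ^ 2 ≤ m * M ^ 2 := hD
    _ ≤ m * (2 * N * m) ^ 2 := by gcongr
    _ = _ := by ring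

lemma aux_sq {n : ℕ} (S : Set (Fin n → ℝ)) (hS : IsCompact S)
    (f : (Fin n → ℝ) → ℝ) (hf : Continuous f) (t c : ℝ) :
    ∫ x in S, (t * f x - c) ^ 2 = t ^ 2 * (∫ x in S, f x ^ 2) - 2 * c * t * (∫ x in S, f x)
      + c ^ 2 * volume.real S := by
  have i1 : IntegrableOn (fun x => 2 * c * t * f x) S :=
    (continuous_const.mul hf).continuousOn.integrableOn_compact hS
  have i2 : IntegrableOn (fun x => t ^ 2 * f x ^ 2) S :=
    (continuous_const.mul (hf.pow 2)).continuousOn.integrableOn_compact hS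
  have i12 : IntegrableOn (fun x => t ^ 2 * f x ^ 2 - 2 * c * t * f x) S := i2.sub i1
  have i3 : IntegrableOn (fun _ => c ^ 2) S := continuousOn_const.integrableOn_compact hS
  have : ∀ x, (t * f x - c) ^ 2 = t ^ 2 * f x ^ 2 - 2 * c * t * f x + c ^ 2 := by
    intro x; ring
  simp_rw [this]
  rw [integral_add i12 i3, integral_sub i2 i1, integral_const_mul, integral_const_mul,
    setIntegral_const, smul_eq_mul]
  ring

lemma aux_star {n : ℕ} (S : Set (Fin n → ℝ)) (hS : IsCompact S)
    (hstar : ∀ t : ℝ, 0 < t → t < 1 → ∀ x ∈ S, t • x ∈ S)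
    (f : (Fin n → ℝ) → ℝ) (hf : Continuous f) (hlin : ∀ (t : ℝ) x, f (t • x) = t * f x) (c : ℝ) :
    0 ≤ ((n : ℝ) + 2) * (∫ x in S, f x ^ 2) - 2 * c * (n + 1) * (∫ x in S, f x)
      + c ^ 2 * n * volume.real S := by
  set M2 := ∫ x in S, f x ^ 2
  set M1 := ∫ x in S, f x
  set V := volume.real S
  have hint : ∀ t : ℝ, ∫ x in S, (f (t • x) - c) ^ 2 = t ^ 2 * M2 - 2 * c * t * M1 + c ^ 2 * V := by
    intro t
    simp_rw [hlin]
    exact aux_sq S hS f hf t c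
  set φ : ℝ → ℝ := fun t => (M2 - 2 * c * M1 + c ^ 2 * V) -
    (t ^ (n + 2) * M2 - 2 * c * t ^ (n + 1) * M1 + c ^ 2 * t ^ n * V) with hφ
  have hpos : ∀ t : ℝ, 0 < t → t < 1 → 0 ≤ φ t := by
    intro t h0 h1
    have hsub : t • S ⊆ S := by
      rintro _ ⟨x, hx, rfl⟩; exact hstar t h0 h1 x hx
    have hle : ∫ x in t • S, (f x - c) ^ 2 ≤ ∫ x in S, (f x - c) ^ 2 := by
      refine setIntegral_mono_set ?_ ?_ hsub.eventuallyLE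
      · exact ((hf.sub continuous_const).pow 2).continuousOn.integrableOn_compact hS
      · exact Filter.Eventually.of_forall fun x => sq_nonneg _
    have e1 := hint 1
    simp only [one_smul] at e1
    have e2 := Measure.setIntegral_comp_smul_of_pos volume (fun x => (f x - c) ^ 2) S h0
    rw [hint t, Module.finrank_fin_fun, smul_eq_mul] at e2
    have e3 : ∫ x in t • S, (f x - c) ^ 2 = t ^ n * (t ^ 2 * M2 - 2 * c * t * M1 + c ^ 2 * V) := by
      rw [e2]; field_simp
    rw [e1, e3] at hle
    simp only [hφ]
    have : t ^ (n + 2) * M2 - 2 * c * t ^ (n + 1) * M1 + c ^ 2 * t ^ n * V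
      = t ^ n * (t ^ 2 * M2 - 2 * c * t * M1 + c ^ 2 * V) := by ring
    rw [this]; linarith
  have hder : HasDerivAt φ (-(((n : ℝ) + 2) * M2 - 2 * c * (n + 1) * M1 + c ^ 2 * n * V)) 1 := by
    have h := ((((hasDerivAt_pow (n + 2) (1 : ℝ)).mul_const M2).sub
      (((hasDerivAt_pow (n + 1) (1 : ℝ)).const_mul (2 * c)).mul_const M1)).add
      (((hasDerivAt_pow n (1 : ℝ)).const_mul (c ^ 2)).mul_const V)).const_sub
        (M2 - 2 * c * M1 + c ^ 2 * V)
    refine HasDerivAt.congr_deriv (f := φ) h ?_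
    push_cast
    simp only [one_pow, mul_one]
  have hlim := (hasDerivWithinAt_iff_tendsto_slope' (s := Set.Iio (1 : ℝ)) (by simp)).1
    hder.hasDerivWithinAt
  have hφ1 : φ 1 = 0 := by simp [hφ]
  have : -(((n : ℝ) + 2) * M2 - 2 * c * (n + 1) * M1 + c ^ 2 * n * V) ≤ 0 := by
    refine le_of_tendsto hlim ?_
    filter_upwards [Ioo_mem_nhdsLT (show (0 : ℝ) < 1 by norm_num)] with t ht
    rw [slope_def_field, hφ1, sub_zero]
    exact div_nonpos_of_nonneg_of_nonpos (hpos t ht.1 ht.2) (by linarith [ht.2])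
  linarith

lemma aux_dot_cont {n : ℕ} (u : Fin n → ℝ) : Continuous (fun x : Fin n → ℝ => u ⬝ᵥ x) := by
  unfold dotProduct; fun_prop

lemma aux_centroid {n : ℕ} (K : Set (Fin n → ℝ)) (hK : IsCompact K) (u : Fin n → ℝ) :
    u ⬝ᵥ centroid K = (volume.real K)⁻¹ * ∫ x in K, u ⬝ᵥ x := by
  have hi : IntegrableOn (fun x : Fin n → ℝ => x) K :=
    continuous_id.continuousOn.integrableOn_compact hK
  have hj : ∀ j, (∫ x in K, x) j = ∫ x in K, x j := by
    intro j
    exact (ContinuousLinearMap.integral_comp_comm (ContinuousLinearMap.proj (R := ℝ) j) hi).symm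
  rw [centroid, dotProduct_smul, smul_eq_mul]
  congr 1
  simp only [dotProduct]
  rw [integral_finsetSum]
  · simp_rw [hj, integral_const_mul]
  · intro i _
    exact (show Continuous fun x : Fin n → ℝ => u i * x i by
      fun_prop).continuousOn.integrableOn_compact hK

lemma aux_cov {n : ℕ} (K : Set (Fin n → ℝ)) (hK : IsCompact K) (u : Fin n → ℝ) :
    u ⬝ᵥ (covMat K *ᵥ u) = (volume.real K)⁻¹ * ∫ x in K, (u ⬝ᵥ x - u ⬝ᵥ centroid K) ^ 2 := by
  have h : ∀ x : Fin n → ℝ, (u ⬝ᵥ x - u ⬝ᵥ centroid K) ^ 2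
      = ∑ i, ∑ j, u i * u j * ((x i - centroid K i) * (x j - centroid K j)) := by
    intro x
    rw [← dotProduct_sub, sq, dotProduct, Finset.sum_mul_sum]
    refine Finset.sum_congr rfl fun i _ => Finset.sum_congr rfl fun j _ => ?_
    simp only [Pi.sub_apply]; ring
  have hc : ∀ i j, IntegrableOn (fun x : Fin n → ℝ =>
      u i * u j * ((x i - centroid K i) * (x j - centroid K j))) K := by
    intro i j
    exact (show Continuous fun x : Fin n → ℝ =>
      u i * u j * ((x i - centroid K i) * (x j - centroid K j)) by
      fun_prop).continuousOn.integrableOn_compact hK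
  simp_rw [h]
  rw [integral_finsetSum _ (fun i _ => integrable_finsetSum _ fun j _ => hc i j)]
  simp_rw [integral_finsetSum _ (fun j _ => hc _ j), integral_const_mul]
  simp only [dotProduct, mulVec, covMat, Finset.mul_sum, Measure.real]
  refine Finset.sum_congr rfl fun i _ => Finset.sum_congr rfl fun j _ => ?_
  ring

lemma aux_var {n : ℕ} (K : Set (Fin n → ℝ)) (hK : IsCompact K) (hV : 0 < volume.real K)
    (u : Fin n → ℝ) (c : ℝ) :
    ∫ x in K, (u ⬝ᵥ x - c) ^ 2
      = volume.real K * (u ⬝ᵥ (covMat K *ᵥ u) + (u ⬝ᵥ centroid K - c) ^ 2) := by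
  have h1 := aux_sq K hK (fun x => u ⬝ᵥ x) (aux_dot_cont u) 1 c
  have h2 := aux_sq K hK (fun x => u ⬝ᵥ x) (aux_dot_cont u) 1 (u ⬝ᵥ centroid K)
  simp only [one_mul] at h1 h2
  have h3 := aux_centroid K hK u
  rw [aux_cov K hK u, h1, h2]
  have h4 : ∫ x in K, u ⬝ᵥ x = volume.real K * (u ⬝ᵥ centroid K) := by
    rw [h3]; field_simp
  rw [h4]
  field_simp
  ring

lemma aux_far {n : ℕ} (hn : 0 < n) (K : Set (Fin n → ℝ)) (hK : IsCompact K)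
    (hconv : Convex ℝ K) (hV : 0 < volume.real K) (p : Fin n → ℝ) (hp : p ∈ K) (u : Fin n → ℝ) :
    (u ⬝ᵥ p - u ⬝ᵥ centroid K) ^ 2 ≤ (n : ℝ) * (n + 2) * (u ⬝ᵥ (covMat K *ᵥ u)) := by
  set S : Set (Fin n → ℝ) := (fun x => x + p) ⁻¹' K with hSdef
  have hS : IsCompact S := (Homeomorph.addRight p).isCompact_preimage.2 hK
  have htr : ∀ g : (Fin n → ℝ) → ℝ, ∫ x in S, g (x + p) = ∫ x in K, g x := fun g =>
    (measurePreserving_add_right volume p).setIntegral_preimage_emb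
      (measurableEmbedding_addRight p) g K
  have hVS : volume.real S = volume.real K := by
    have := htr (fun _ => 1)
    simpa using this
  set C := u ⬝ᵥ (covMat K *ᵥ u)
  set d := u ⬝ᵥ centroid K - u ⬝ᵥ p with hd
  have e2 : ∫ x in S, (u ⬝ᵥ x) ^ 2 = volume.real K * (C + d ^ 2) := by
    rw [← aux_var K hK hV u (u ⬝ᵥ p), ← htr]
    simp [dotProduct_add]
  have e1 : ∫ x in S, u ⬝ᵥ x = volume.real K * d := by
    have i1 : IntegrableOn (fun x => u ⬝ᵥ x) K :=
      (aux_dot_cont u).continuousOn.integrableOn_compact hK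
    have i2 : IntegrableOn (fun _ : Fin n → ℝ => u ⬝ᵥ p) K :=
      continuousOn_const.integrableOn_compact hK
    have : ∫ x in K, (u ⬝ᵥ x - u ⬝ᵥ p) = volume.real K * d := by
      rw [integral_sub i1 i2, setIntegral_const, hd, aux_centroid K hK u, smul_eq_mul]
      field_simp
    rw [← this, ← htr]
    simp [dotProduct_add]
  have hn' : (0 : ℝ) < n := by exact_mod_cast hn
  have key := aux_star S hS ?_ (fun x => u ⬝ᵥ x) (aux_dot_cont u)
    (fun t x => by simp [dotProduct_smul]) ((n + 1) * d / n)
  · rw [e1, e2, hVS] at key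
    have hk : ((n : ℝ) + 2) * (volume.real K * (C + d ^ 2)) - 2 * ((n + 1) * d / n) * (n + 1) *
        (volume.real K * d) + ((n + 1) * d / n) ^ 2 * n * volume.real K
        = (volume.real K / n) * (n * (n + 2) * C - d ^ 2) := by
      field_simp; ring
    rw [hk] at key
    have := nonneg_of_mul_nonneg_right key (by positivity)
    have hdd : (u ⬝ᵥ p - u ⬝ᵥ centroid K) ^ 2 = d ^ 2 := by rw [hd]; ring
    rw [hdd]; linarith
  · intro t h0 h1 x hx
    have := hconv hx hp h0.le (by linarith : 0 ≤ 1 - t) (by ring)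
    rw [hSdef, Set.mem_preimage]
    convert this using 1
    module

lemma aux_Hquad {m n : ℕ} (A : Matrix (Fin m) (Fin n) ℝ) (b : Fin m → ℝ) (x v : Fin n → ℝ) :
    v ⬝ᵥ (Hmat A b x *ᵥ v) = ∑ i, ((A i ⬝ᵥ v) / (A i ⬝ᵥ x - b i)) ^ 2 := by
  rw [Hmat, sum_mulVec, dotProduct_sum]
  refine Finset.sum_congr rfl fun i _ => ?_
  rw [smul_mulVec, vecMulVec_mulVec, dotProduct_smul, dotProduct_smul, dotProduct_comm v (A i)]
  simp only [smul_eq_mul, MulOpposite.smul_eq_mul_unop, MulOpposite.unop_op]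
  rw [div_pow, div_eq_inv_mul]; ring

lemma aux_Htrace {m n : ℕ} (A : Matrix (Fin m) (Fin n) ℝ) (b : Fin m → ℝ) (x : Fin n → ℝ)
    (M : Matrix (Fin n) (Fin n) ℝ) :
    (M * Hmat A b x).trace = ∑ i, ((A i ⬝ᵥ x - b i) ^ 2)⁻¹ * (A i ⬝ᵥ (M *ᵥ A i)) := by
  rw [Hmat, Finset.mul_sum, trace_sum]
  refine Finset.sum_congr rfl fun i _ => ?_
  rw [Matrix.mul_smul, trace_smul, mul_vecMulVec, trace_vecMulVec, smul_eq_mul,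
    dotProduct_comm (A i) (M *ᵥ A i)]

lemma aux_Hherm {m n : ℕ} (A : Matrix (Fin m) (Fin n) ℝ) (b : Fin m → ℝ) (x : Fin n → ℝ) :
    (Hmat A b x).IsHermitian := by
  ext i j
  simp [Hmat, Matrix.sum_apply, vecMulVec_apply, mul_comm]

lemma aux_Hpos {m n : ℕ} (A : Matrix (Fin m) (Fin n) ℝ) (b : Fin m → ℝ)
    (hbd : Bornology.IsBounded {x : Fin n → ℝ | ∀ i, A i ⬝ᵥ x ≥ b i})
    (x : Fin n → ℝ) (hx : ∀ i, A i ⬝ᵥ x > b i) : (Hmat A b x).PosDef := by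
  refine .of_dotProduct_mulVec_pos (aux_Hherm A b x) fun v hv => ?_
  rw [star_trivial, aux_Hquad]
  refine lt_of_le_of_ne (Finset.sum_nonneg fun i _ => sq_nonneg _) fun h0 => ?_
  have hz : ∀ i, A i ⬝ᵥ v = 0 := by
    intro i
    have := (Finset.sum_eq_zero_iff_of_nonneg (fun i _ => sq_nonneg _)).1 h0.symm i
      (Finset.mem_univ i)
    have h1 := pow_eq_zero_iff (two_ne_zero) |>.1 this
    rcases div_eq_zero_iff.1 h1 with h | h
    · exact h
    · linarith [hx i]
  obtain ⟨R, hR⟩ := hbd.exists_norm_le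
  have hmem : ∀ t : ℝ, ‖x + t • v‖ ≤ R := by
    intro t
    refine hR _ fun i => ?_
    rw [dotProduct_add, dotProduct_smul, hz i]
    simpa using (hx i).le
  have hvn : 0 < ‖v‖ := norm_pos_iff.2 hv
  have h1 := hmem ((R + ‖x‖ + 1) / ‖v‖)
  have hR0 : 0 ≤ R := (norm_nonneg _).trans h1
  have h2 : ‖((R + ‖x‖ + 1) / ‖v‖) • v‖ = R + ‖x‖ + 1 := by
    rw [norm_smul, Real.norm_of_nonneg (by positivity)]; field_simp
  have h3 := norm_sub_le (x + ((R + ‖x‖ + 1) / ‖v‖) • v) x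
  rw [add_sub_cancel_left, h2] at h3
  linarith

lemma aux_first_order {m n : ℕ} (A : Matrix (Fin m) (Fin n) ℝ) (b : Fin m → ℝ)
    (hbd : Bornology.IsBounded {x : Fin n → ℝ | ∀ i, A i ⬝ᵥ x ≥ b i})
    (vc : Fin n → ℝ) (hvc : ∀ i, A i ⬝ᵥ vc > b i)
    (hmin : ∀ x : Fin n → ℝ, (∀ i, A i ⬝ᵥ x > b i) → Fvol A b vc ≤ Fvol A b x)
    (v : Fin n → ℝ) (σ w : Fin m → ℝ)
    (hσ : ∀ i, σ i = ((A i ⬝ᵥ vc - b i) ^ 2)⁻¹ * (A i ⬝ᵥ ((Hmat A b vc)⁻¹ *ᵥ A i)))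
    (hw : ∀ i, w i = (A i ⬝ᵥ v) / (A i ⬝ᵥ vc - b i)) (hs : ∑ i, σ i = n) :
    ∑ i, σ i * w i = 0 := by
  have hs0 : ∀ i, A i ⬝ᵥ vc - b i ≠ 0 := fun i => (sub_pos.2 (hvc i)).ne'
  have hP := aux_Hpos A b hbd vc hvc
  set φ : ℝ → ℝ := fun t => ∑ i, σ i * ((1 + t * w i) ^ 2)⁻¹ with hφ
  have hφ0 : φ 0 = n := by simp [hφ, hs]
  have hloc : IsLocalMin φ 0 := by
    have hev : ∀ᶠ t : ℝ in nhds 0, ∀ i, A i ⬝ᵥ (vc + t • v) > b i := by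
      rw [Filter.eventually_all]
      intro i
      have hc : Continuous fun t : ℝ => A i ⬝ᵥ (vc + t • v) :=
        (aux_dot_cont (A i)).comp (by fun_prop)
      have := hc.tendsto 0
      simp only [zero_smul, add_zero] at this
      exact this.eventually_const_lt (hvc i)
    filter_upwards [hev] with t ht
    rw [hφ0]
    have hQ := aux_Hpos A b hbd _ ht
    have hF := hmin _ ht
    have hdet : (Hmat A b vc).det ≤ (Hmat A b (vc + t • v)).det := by
      rw [← Real.log_le_log_iff hP.det_pos hQ.det_pos]
      unfold Fvol at hF
      linarith
    have := aux_trace hP hQ hdet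
    rw [aux_Htrace] at this
    refine this.trans (le_of_eq (Finset.sum_congr rfl fun i _ => ?_))
    have e : A i ⬝ᵥ (vc + t • v) - b i = (A i ⬝ᵥ vc - b i) * (1 + t * w i) := by
      rw [hw, dotProduct_add, dotProduct_smul, smul_eq_mul]
      field_simp [hs0 i]
      ring
    rw [e, hσ, mul_pow, mul_inv]; ring
  have hder : HasDerivAt φ (∑ i, σ i * (-2 * w i)) 0 := by
    refine HasDerivAt.fun_sum fun i _ => ?_
    refine HasDerivAt.const_mul _ ?_
    have h1 : HasDerivAt (fun t : ℝ => 1 + t * w i) (w i) 0 := by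
      simpa using ((hasDerivAt_id (0 : ℝ)).mul_const (w i)).const_add 1
    have h2 := (h1.fun_pow 2).fun_inv (by simp)
    refine h2.congr_deriv ?_
    simp
  have := hloc.hasDerivAt_eq_zero hder
  have e : ∑ i, σ i * (-2 * w i) = -2 * ∑ i, σ i * w i := by
    rw [Finset.mul_sum]; exact Finset.sum_congr rfl fun i _ => by ring
  rw [e] at this
  linarith

lemma aux_incl {m n : ℕ} (A : Matrix (Fin m) (Fin n) ℝ) (b : Fin m → ℝ)
    (hbd : Bornology.IsBounded {x : Fin n → ℝ | ∀ i, A i ⬝ᵥ x ≥ b i})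
    (vc : Fin n → ℝ) (hvc : ∀ i, A i ⬝ᵥ vc > b i)
    (hmin : ∀ x : Fin n → ℝ, (∀ i, A i ⬝ᵥ x > b i) → Fvol A b vc ≤ Fvol A b x)
    (y : Fin n → ℝ) (hy : ∀ i, A i ⬝ᵥ y ≥ b i) :
    (y - vc) ⬝ᵥ (Hmat A b vc *ᵥ (y - vc)) ≤ 4 * (m : ℝ) ^ 3 * (n : ℝ) ^ 2 := by
  have hP := aux_Hpos A b hbd vc hvc
  set P := Hmat A b vc with hPdef
  have hu : IsUnit P.det := (Matrix.isUnit_iff_isUnit_det _).1 hP.isUnit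
  set σ : Fin m → ℝ := fun i => ((A i ⬝ᵥ vc - b i) ^ 2)⁻¹ * (A i ⬝ᵥ (P⁻¹ *ᵥ A i)) with hσ
  set w : Fin m → ℝ := fun i => (A i ⬝ᵥ (y - vc)) / (A i ⬝ᵥ vc - b i) with hw
  have hs : ∑ i, σ i = n := by
    have := aux_Htrace A b vc P⁻¹
    rw [← hPdef, Matrix.nonsing_inv_mul _ hu, trace_one, Fintype.card_fin] at this
    rw [this]
  have hq : (y - vc) ⬝ᵥ (P *ᵥ (y - vc)) = ∑ j, w j ^ 2 := aux_Hquad A b vc (y - vc)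
  rw [hq]
  refine aux_real n σ w ?_ hs ?_ ?_ ?_
  · intro i
    have := hP.inv.posSemidef.dotProduct_mulVec_nonneg (A i)
    rw [star_trivial] at this
    exact mul_nonneg (by positivity) this
  · exact aux_first_order A b hbd vc hvc hmin (y - vc) σ w (fun _ => rfl) (fun _ => rfl) hs
  · intro i
    have := hvc i
    have h1 := hy i
    simp only [hw]
    rw [le_div_iff₀ (by linarith), dotProduct_sub]
    linarith
  · intro i
    have h1 := aux_cs_inv hP (y - vc) (A i)
    rw [hq, dotProduct_comm] at h1
    simp only [hw, hσ]
    rw [div_pow, div_eq_inv_mul, mul_assoc]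
    refine mul_le_mul_of_nonneg_left ?_ (by positivity)
    rw [mul_comm]
    exact h1

lemma aux_covHerm {n : ℕ} (K : Set (Fin n → ℝ)) : (covMat K).IsHermitian := by
  ext i j
  simp [covMat, mul_comm]

/-- For a bounded polytope `K = {x | A x ≥ b}` with nonempty interior and volumetric
center `vc`, we have `(1/(4 m³ n²)) H(vc) ⪯ Cov(K)⁻¹ ⪯ 4 n² H(vc)` in the Loewner order. -/
theorem hessian_covariance_close {m n : ℕ} (A : Matrix (Fin m) (Fin n) ℝ) (b : Fin m → ℝ)
    (K : Set (Fin n → ℝ)) (hK : K = {x : Fin n → ℝ | ∀ i, A i ⬝ᵥ x ≥ b i})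
    (hbd : Bornology.IsBounded K)
    (vc : Fin n → ℝ) (hvc : ∀ i, A i ⬝ᵥ vc > b i)
    (hmin : ∀ x : Fin n → ℝ, (∀ i, A i ⬝ᵥ x > b i) → Fvol A b vc ≤ Fvol A b x) :
    ((covMat K)⁻¹ - (4 * (m : ℝ) ^ 3 * (n : ℝ) ^ 2)⁻¹ • Hmat A b vc).PosSemidef ∧
    ((4 * (n : ℝ) ^ 2) • Hmat A b vc - (covMat K)⁻¹).PosSemidef := by
  rcases Nat.eq_zero_or_pos n with rfl | hn
  · constructor
    · rw [Subsingleton.elim ((covMat K)⁻¹ - _) 0]; exact .zero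
    · rw [Subsingleton.elim (_ - (covMat K)⁻¹) 0]; exact .zero
  have hbd' : Bornology.IsBounded {x : Fin n → ℝ | ∀ i, A i ⬝ᵥ x ≥ b i} := hK ▸ hbd
  have hP := aux_Hpos A b hbd' vc hvc
  have hincl := aux_incl A b hbd' vc hvc hmin
  have hmem : ∀ x, x ∈ K ↔ ∀ i, A i ⬝ᵥ x ≥ b i := fun x => by rw [hK]; rfl
  have hclosed : IsClosed K := by
    rw [hK, Set.ofPred_forall]
    exact isClosed_iInter fun i => isClosed_le continuous_const (aux_dot_cont (A i))
  have hcomp : IsCompact K := Metric.isCompact_of_isClosed_isBounded hclosed hbd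
  have hconv : Convex ℝ K := by
    intro x hx y hy s t hs ht hst
    rw [hmem] at hx hy ⊢
    intro i
    rw [dotProduct_add, dotProduct_smul, dotProduct_smul, smul_eq_mul, smul_eq_mul]
    have h1 := mul_le_mul_of_nonneg_left (hx i) hs
    have h2 := mul_le_mul_of_nonneg_left (hy i) ht
    have h3 : b i = s * b i + t * b i := by rw [← add_mul, hst, one_mul]
    linarith
  have hV : 0 < volume.real K := by
    have hopen : IsOpen {x : Fin n → ℝ | ∀ i, b i < A i ⬝ᵥ x} := by
      rw [Set.ofPred_forall]
      exact isOpen_iInter_of_finite fun i => isOpen_lt continuous_const (aux_dot_cont (A i))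
    have hsub : {x : Fin n → ℝ | ∀ i, b i < A i ⬝ᵥ x} ⊆ K := fun x hx =>
      (hmem x).2 fun i => (hx i).le
    have hp := (hopen.measure_pos volume ⟨vc, hvc⟩).trans_le (measure_mono hsub)
    exact ENNReal.toReal_pos hp.ne' hcomp.measure_lt_top.ne
  set P := Hmat A b vc with hPdef
  set C := covMat K with hCdef
  have hn1 : (1 : ℝ) ≤ n := by exact_mod_cast hn
  have hC0 : ∀ u, 0 ≤ u ⬝ᵥ (C *ᵥ u) := by
    intro u
    rw [hCdef, aux_cov K hcomp u]
    exact mul_nonneg (inv_nonneg.2 hV.le) (integral_nonneg fun x => sq_nonneg _)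
  -- bound (a), for normalized vectors
  have ha1 : ∀ u v : Fin n → ℝ, v ⬝ᵥ (P *ᵥ v) ≤ 1 → (u ⬝ᵥ v) ^ 2 ≤
      4 * (n : ℝ) ^ 2 * (u ⬝ᵥ (C *ᵥ u)) := by
    intro u v hv
    rw [hPdef, aux_Hquad] at hv
    have hdik : ∀ i, |A i ⬝ᵥ v| ≤ A i ⬝ᵥ vc - b i := by
      intro i
      have hs : 0 < A i ⬝ᵥ vc - b i := sub_pos.2 (hvc i)
      have h1 : ((A i ⬝ᵥ v) / (A i ⬝ᵥ vc - b i)) ^ 2 ≤ 1 :=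
        (Finset.single_le_sum (f := fun i => ((A i ⬝ᵥ v) / (A i ⬝ᵥ vc - b i)) ^ 2)
          (fun i _ => sq_nonneg _) (Finset.mem_univ i)).trans hv
      rw [sq_le_one_iff_abs_le_one, abs_div, abs_of_pos hs, div_le_one hs] at h1
      exact h1
    have hm1 : vc + v ∈ K := by
      rw [hmem]; intro i; rw [dotProduct_add]
      linarith [(abs_le.1 (hdik i)).1]
    have hm2 : vc - v ∈ K := by
      rw [hmem]; intro i; rw [dotProduct_sub]
      linarith [(abs_le.1 (hdik i)).2]
    have f1 := aux_far hn K hcomp hconv hV _ hm1 u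
    have f2 := aux_far hn K hcomp hconv hV _ hm2 u
    rw [dotProduct_add] at f1
    rw [dotProduct_sub] at f2
    have hnn : (n : ℝ) * (n + 2) * (u ⬝ᵥ (C *ᵥ u)) ≤ 4 * (n : ℝ) ^ 2 * (u ⬝ᵥ (C *ᵥ u)) := by
      refine mul_le_mul_of_nonneg_right ?_ (hC0 u)
      nlinarith
    nlinarith [sq_nonneg (u ⬝ᵥ vc - u ⬝ᵥ centroid K)]
  have ha : ∀ u v : Fin n → ℝ, (u ⬝ᵥ v) ^ 2 ≤
      4 * (n : ℝ) ^ 2 * (u ⬝ᵥ (C *ᵥ u)) * (v ⬝ᵥ (P *ᵥ v)) := by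
    intro u v
    by_cases hv : v = 0
    · simp [hv]
    have hq : 0 < v ⬝ᵥ (P *ᵥ v) := by simpa using hP.dotProduct_mulVec_pos hv
    set q := v ⬝ᵥ (P *ᵥ v) with hqd
    have hr : 0 < Real.sqrt q := Real.sqrt_pos.2 hq
    have hrr : Real.sqrt q * Real.sqrt q = q := Real.mul_self_sqrt hq.le
    have := ha1 u ((Real.sqrt q)⁻¹ • v) (by
      rw [mulVec_smul, dotProduct_smul, smul_dotProduct, smul_eq_mul, smul_eq_mul, ← hqd,
        ← mul_assoc, ← mul_inv, hrr, inv_mul_cancel₀ hq.ne'])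
    rw [dotProduct_smul, smul_eq_mul, mul_pow, inv_pow, Real.sq_sqrt hq.le, inv_mul_le_iff₀ hq]
      at this
    linarith
  have hCpos : C.PosDef := by
    refine .of_dotProduct_mulVec_pos (aux_covHerm K) fun u hu => ?_
    rw [star_trivial]
    refine lt_of_le_of_ne (hC0 u) fun h0 => ?_
    have := ha u u
    rw [← h0] at this
    have h1 : u ⬝ᵥ u = 0 := by
      have : (u ⬝ᵥ u) ^ 2 ≤ 0 := by linarith
      exact pow_eq_zero_iff two_ne_zero |>.1 (le_antisymm this (sq_nonneg _))
    exact hu (dotProduct_self_eq_zero.1 h1)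
  have hCu : IsUnit C.det := (Matrix.isUnit_iff_isUnit_det _).1 hCpos.isUnit
  have hCi0 : ∀ v, 0 ≤ v ⬝ᵥ (C⁻¹ *ᵥ v) := fun v => by
    simpa using hCpos.inv.posSemidef.dotProduct_mulVec_nonneg v
  have hP0 : ∀ v, 0 ≤ v ⬝ᵥ (P *ᵥ v) := fun v => by
    simpa using hP.posSemidef.dotProduct_mulVec_nonneg v
  -- bound (b)
  set k : ℝ := 4 * (m : ℝ) ^ 3 * (n : ℝ) ^ 2 with hk
  have hk0 : 0 ≤ k := by positivity
  have hb : ∀ v, (P *ᵥ v) ⬝ᵥ (C *ᵥ (P *ᵥ v)) ≤ k * (v ⬝ᵥ (P *ᵥ v)) := by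
    intro v
    have e := aux_var K hcomp hV (P *ᵥ v) ((P *ᵥ v) ⬝ᵥ vc)
    have hle : ∫ x in K, ((P *ᵥ v) ⬝ᵥ x - (P *ᵥ v) ⬝ᵥ vc) ^ 2
        ≤ ∫ x in K, k * (v ⬝ᵥ (P *ᵥ v)) := by
      refine setIntegral_mono_on ?_ ?_ hclosed.measurableSet ?_
      · exact (((aux_dot_cont _).sub continuous_const).pow 2).continuousOn.integrableOn_compact
          hcomp
      · exact continuousOn_const.integrableOn_compact hcomp
      · intro x hx
        have h1 := aux_cs hP.posSemidef (x - vc) v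
        have h2 := hincl x ((hmem x).1 hx)
        rw [← dotProduct_sub, dotProduct_comm]
        exact h1.trans (mul_le_mul_of_nonneg_right h2 (hP0 v))
    rw [e, setIntegral_const, smul_eq_mul] at hle
    have := le_of_mul_le_mul_left hle hV
    linarith [sq_nonneg ((P *ᵥ v) ⬝ᵥ centroid K - (P *ᵥ v) ⬝ᵥ vc)]
  constructor
  · refine .of_dotProduct_mulVec_nonneg ?_ fun v => ?_
    · refine hCpos.inv.isHermitian.sub ?_
      rw [IsHermitian, conjTranspose_smul, star_trivial, hP.isHermitian.eq]
    rw [star_trivial, sub_mulVec, dotProduct_sub, smul_mulVec, dotProduct_smul, smul_eq_mul,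
      sub_nonneg]
    rcases hk0.eq_or_lt with h | h
    · rw [← h]; simpa using hCi0 v
    rw [inv_mul_le_iff₀ h]
    rcases (hP0 v).eq_or_lt with h1 | h1
    · rw [← h1]; exact mul_nonneg hk0 (hCi0 v)
    have c1 := aux_cs_inv hCpos (P *ᵥ v) v
    rw [dotProduct_comm (P *ᵥ v) v] at c1
    have c2 := c1.trans (mul_le_mul_of_nonneg_right (hb v) (hCi0 v))
    refine le_of_mul_le_mul_left (a := v ⬝ᵥ (P *ᵥ v)) ?_ h1
    linarith
  · refine .of_dotProduct_mulVec_nonneg ?_ fun v => ?_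
    · refine IsHermitian.sub ?_ hCpos.inv.isHermitian
      rw [IsHermitian, conjTranspose_smul, star_trivial, hP.isHermitian.eq]
    rw [star_trivial, sub_mulVec, dotProduct_sub, smul_mulVec, dotProduct_smul, smul_eq_mul,
      sub_nonneg]
    rcases (hCi0 v).eq_or_lt with h1 | h1
    · rw [← h1]; exact mul_nonneg (by positivity) (hP0 v)
    have c1 := ha (C⁻¹ *ᵥ v) v
    rw [mulVec_mulVec, Matrix.mul_nonsing_inv _ hCu, one_mulVec, dotProduct_comm _ v] at c1
    refine le_of_mul_le_mul_left (a := v ⬝ᵥ (C⁻¹ *ᵥ v)) ?_ h1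
    linarith
end

section
/- Let K = {x ∈ ℝ^n : Ax ≥ b} be a bounded polytope with nonempty interior (A ∈ ℝ^{m×n} with rows a_1ᵀ,…,a_mᵀ, b ∈ ℝ^m, and A of rank n), and let F(x) = (1/2) ln det H(x) on the interior of K. Then F is twice continuously differentiable on the interior of K, and for every interior point x and every direction v ∈ ℝ^n, vᵀ Q(x) v ≤ D²F(x)[v, v] ≤ 5 vᵀ Q(x) v, where D²F(x) is the second derivative (Hessian) of F at x; i.e., Q(x) ⪯ ∇²F(x) ⪯ 5 Q(x). -/
open Matrix

/-- The leverage scores `σᵢ(x) = aᵢᵀ H(x)⁻¹ aᵢ / (aᵢᵀ x - bᵢ)²`. -/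
noncomputable def lev {m n : ℕ} (A : Matrix (Fin m) (Fin n) ℝ) (b : Fin m → ℝ)
    (x : Fin n → ℝ) (i : Fin m) : ℝ :=
  (A i ⬝ᵥ (Hmat A b x)⁻¹ *ᵥ A i) / (A i ⬝ᵥ x - b i) ^ 2

/-- The matrix `Q(x) = ∑ i, σᵢ(x) aᵢ aᵢᵀ / (aᵢᵀ x - bᵢ)²`. -/
noncomputable def Qmat {m n : ℕ} (A : Matrix (Fin m) (Fin n) ℝ) (b : Fin m → ℝ)
    (x : Fin n → ℝ) : Matrix (Fin n) (Fin n) ℝ :=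
  ∑ i, (lev A b x i / (A i ⬝ᵥ x - b i) ^ 2) • Matrix.vecMulVec (A i) (A i)

section VolAux

open scoped Matrix.Norms.Operator

/-- Weighted sum of the rank one matrices. -/
noncomputable def wsum {m n : ℕ} (A : Matrix (Fin m) (Fin n) ℝ) (c : Fin m → ℝ) :
    Matrix (Fin n) (Fin n) ℝ :=
  ∑ i, c i • Matrix.vecMulVec (A i) (A i)

lemma wsum_quad {m n : ℕ} (A : Matrix (Fin m) (Fin n) ℝ) (c : Fin m → ℝ) (u v : Fin n → ℝ) :
    u ⬝ᵥ (wsum A c *ᵥ v) = ∑ i, c i * (A i ⬝ᵥ u) * (A i ⬝ᵥ v) := by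
  unfold wsum
  rw [Matrix.sum_mulVec, dotProduct_sum]
  refine Finset.sum_congr rfl fun i _ => ?_
  rw [Matrix.smul_mulVec, Matrix.vecMulVec_mulVec, dotProduct_smul, dotProduct_smul,
    dotProduct_comm u (A i)]
  simp
  ring

lemma wsum_trace {m n : ℕ} (A : Matrix (Fin m) (Fin n) ℝ) (c : Fin m → ℝ)
    (M : Matrix (Fin n) (Fin n) ℝ) :
    (M * wsum A c).trace = ∑ i, c i * (A i ⬝ᵥ (M *ᵥ A i)) := by
  unfold wsum
  rw [Finset.mul_sum, Matrix.trace_sum]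
  refine Finset.sum_congr rfl fun i _ => ?_
  rw [Matrix.mul_smul, Matrix.trace_smul, Matrix.mul_vecMulVec, Matrix.trace_vecMulVec,
    dotProduct_comm, smul_eq_mul]

lemma wsum_isSymm {m n : ℕ} (A : Matrix (Fin m) (Fin n) ℝ) (c : Fin m → ℝ) :
    (wsum A c)ᵀ = wsum A c := by
  unfold wsum
  rw [Matrix.transpose_sum]
  refine Finset.sum_congr rfl fun i _ => ?_
  rw [Matrix.transpose_smul, Matrix.transpose_vecMulVec]

lemma wsum_posDef {m n : ℕ} (A : Matrix (Fin m) (Fin n) ℝ) (hrank : A.rank = n)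
    (c : Fin m → ℝ) (hc : ∀ i, 0 < c i) : (wsum A c).PosDef := by
  have hinj : ∀ v : Fin n → ℝ, (∀ i, A i ⬝ᵥ v = 0) → v = 0 := by
    intro v hv
    have h1 := LinearMap.finrank_range_add_finrank_ker A.mulVecLin
    have h2 : Module.finrank ℝ (LinearMap.range A.mulVecLin) = n := hrank
    rw [h2] at h1
    simp at h1
    have h3 : v ∈ LinearMap.ker A.mulVecLin := by
      rw [LinearMap.mem_ker, Matrix.mulVecLin_apply]
      funext i
      exact hv i
    rw [h1] at h3
    simpa using h3
  rw [Matrix.posDef_iff_dotProduct_mulVec]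
  refine ⟨?_, ?_⟩
  · rw [Matrix.IsHermitian, Matrix.conjTranspose_eq_transpose_of_trivial, wsum_isSymm]
  · intro v hv
    simp only [star_trivial]
    rw [wsum_quad]
    have hnn : ∀ i, 0 ≤ c i * (A i ⬝ᵥ v) * (A i ⬝ᵥ v) := fun i => by
      rw [mul_assoc]; exact mul_nonneg (hc i).le (mul_self_nonneg _)
    refine lt_of_le_of_ne (Finset.sum_nonneg fun i _ => hnn i) ?_
    intro h
    apply hv
    apply hinj
    intro i
    have := (Finset.sum_eq_zero_iff_of_nonneg (fun i _ => hnn i)).1 h.symm i (Finset.mem_univ i)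
    have h4 := (hc i).ne'
    simpa [h4] using this

lemma contDiff_det_aux {n : ℕ} {k : WithTop ℕ∞} :
    ContDiff ℝ k (fun M : Matrix (Fin n) (Fin n) ℝ => M.det) := by
  have hentry : ∀ i j, ContDiff ℝ k (fun M : Matrix (Fin n) (Fin n) ℝ => M i j) := fun i j =>
    (LinearMap.toContinuousLinearMap (Matrix.entryLinearMap ℝ ℝ i j)).contDiff
  simp only [Matrix.det_apply]
  refine ContDiff.sum fun σ _ => ?_
  refine ContDiff.const_smul _ ?_
  exact contDiff_prod fun i _ => hentry _ _

/-- Jacobi's formula. -/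
lemma fderiv_det_aux {n : ℕ} (M N : Matrix (Fin n) (Fin n) ℝ) (hM : IsUnit M.det) :
    fderiv ℝ (fun M : Matrix (Fin n) (Fin n) ℝ => M.det) M N = M.det * (M⁻¹ * N).trace := by
  have hd : DifferentiableAt ℝ (fun M : Matrix (Fin n) (Fin n) ℝ => M.det) M :=
    (contDiff_det_aux (k := 1)).differentiable (by simp) M
  have hline : HasDerivAt (fun t : ℝ => M + t • N) N 0 := by
    exact (((hasDerivAt_id (0 : ℝ)).smul_const N).const_add M).congr_deriv (one_smul _ _)
  have h1 : HasDerivAt (fun t : ℝ => (M + t • N).det)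
      (fderiv ℝ (fun M : Matrix (Fin n) (Fin n) ℝ => M.det) M N) 0 := by
    have hd' : HasFDerivAt (fun M : Matrix (Fin n) (Fin n) ℝ => M.det)
      (fderiv ℝ (fun M : Matrix (Fin n) (Fin n) ℝ => M.det) M) (M + (0 : ℝ) • N) := by
      simpa using hd.hasFDerivAt
    exact hd'.comp_hasDerivAt (0 : ℝ) hline
  refine h1.unique ?_
  obtain ⟨p, hp⟩ : ∃ p : Polynomial ℝ, ∀ t : ℝ, (M + t • N).det =
      M.det * (1 + (M⁻¹ * N).trace * t + p.eval t * t ^ 2) := by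
    have key : ∀ t : ℝ, (M + t • N).det = M.det * (1 + t • (M⁻¹ * N)).det := fun t => by
      rw [← Matrix.det_mul, mul_add, mul_one, Matrix.mul_smul,
        Matrix.mul_nonsing_inv_cancel_left _ _ hM]
    exact ⟨_, fun t => by rw [key, Matrix.det_one_add_smul]⟩
  have h2 : (fun t : ℝ => (M + t • N).det) =
      fun t => M.det * (1 + (M⁻¹ * N).trace * t + p.eval t * t ^ 2) := funext hp
  rw [h2]
  have h3 : HasDerivAt (fun t : ℝ => p.eval t * t ^ 2) 0 0 := by
    exact ((p.hasDerivAt 0).mul ((hasDerivAt_id (0 : ℝ)).pow 2)).congr_deriv (by simp)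
  have h4 : HasDerivAt (fun t : ℝ => 1 + (M⁻¹ * N).trace * t) (M⁻¹ * N).trace 0 := by
    simpa using ((hasDerivAt_id (0 : ℝ)).const_mul (M⁻¹ * N).trace).const_add 1
  simpa using (h4.add h3).const_mul M.det

lemma hasDerivAt_wsum {m n : ℕ} (A : Matrix (Fin m) (Fin n) ℝ) (c : ℝ → Fin m → ℝ)
    (c' : Fin m → ℝ) (t : ℝ) (h : ∀ i, HasDerivAt (fun s => c s i) (c' i) t) :
    HasDerivAt (fun s => wsum A (c s)) (wsum A c') t := by
  unfold wsum
  exact HasDerivAt.fun_sum fun i _ => (h i).smul_const _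

lemma hasDerivAt_logdet {n : ℕ} (M : ℝ → Matrix (Fin n) (Fin n) ℝ)
    (M' : Matrix (Fin n) (Fin n) ℝ) (t : ℝ) (h : HasDerivAt M M' t) (hM : (M t).det ≠ 0) :
    HasDerivAt (fun s => (1 / 2) * Real.log (M s).det) ((1 / 2) * ((M t)⁻¹ * M').trace) t := by
  have hd : HasFDerivAt (fun M : Matrix (Fin n) (Fin n) ℝ => M.det) _ (M t) :=
    ((contDiff_det_aux (k := 1)).differentiable (by simp) (M t)).hasFDerivAt
  have h1 := hd.comp_hasDerivAt t h
  have h1' : HasDerivAt (fun s => (M s).det) ((M t).det * ((M t)⁻¹ * M').trace) t :=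
    h1.congr_deriv (fderiv_det_aux _ _ (isUnit_iff_ne_zero.2 hM))
  have h2 := (h1'.log hM).const_mul (1 / 2)
  refine h2.congr_deriv ?_
  field_simp

lemma hasDerivAt_matinv {n : ℕ} (M : ℝ → Matrix (Fin n) (Fin n) ℝ)
    (M' : Matrix (Fin n) (Fin n) ℝ) (t : ℝ) (h : HasDerivAt M M' t) (hM : (M t).det ≠ 0) :
    HasDerivAt (fun s => (M s)⁻¹) (-((M t)⁻¹ * M' * (M t)⁻¹)) t := by
  have hu : IsUnit (M t) := (Matrix.isUnit_iff_isUnit_det _).2 (isUnit_iff_ne_zero.2 hM)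
  obtain ⟨u, hu⟩ := hu
  have h0 := hasFDerivAt_ringInverse (𝕜 := ℝ) u
  rw [hu] at h0
  have h1 := h0.comp_hasDerivAt t h
  have h2 : ((u⁻¹ : (Matrix (Fin n) (Fin n) ℝ)ˣ) : Matrix (Fin n) (Fin n) ℝ) = (M t)⁻¹ := by
    rw [← hu, Matrix.coe_units_inv]
  have h3 : (fun s => (M s)⁻¹) = Ring.inverse ∘ M := by
    funext s; simp [Matrix.nonsing_inv_eq_ringInverse]
  rw [h3]
  refine h1.congr_deriv ?_
  simp [h2]

lemma hasDerivAt_half_trace {n : ℕ} (M N : ℝ → Matrix (Fin n) (Fin n) ℝ)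
    (M' N' : Matrix (Fin n) (Fin n) ℝ) (t : ℝ) (h : HasDerivAt M M' t) (hN : HasDerivAt N N' t)
    (hM : (M t).det ≠ 0) :
    HasDerivAt (fun s => (1 / 2) * ((M s)⁻¹ * N s).trace)
      ((1 / 2) * (((M t)⁻¹ * N').trace - (((M t)⁻¹ * M' * (M t)⁻¹) * N t).trace)) t := by
  have h1 := (hasDerivAt_matinv M M' t h hM).mul hN
  have h2 := (LinearMap.toContinuousLinearMap
    (Matrix.traceLinearMap (Fin n) ℝ ℝ)).hasFDerivAt.comp_hasDerivAt t h1
  have h3 := h2.const_mul (1 / 2)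
  refine h3.congr_deriv ?_
  change (1 / 2) * (-((M t)⁻¹ * M' * (M t)⁻¹) * N t + (M t)⁻¹ * N').trace = _
  rw [Matrix.trace_add, neg_mul, Matrix.trace_neg]
  ring

lemma Hmat_eq {m n : ℕ} (A : Matrix (Fin m) (Fin n) ℝ) (b : Fin m → ℝ) (x : Fin n → ℝ) :
    Hmat A b x = wsum A (fun i => ((A i ⬝ᵥ x - b i) ^ 2)⁻¹) := rfl

lemma Qmat_eq {m n : ℕ} (A : Matrix (Fin m) (Fin n) ℝ) (b : Fin m → ℝ) (x : Fin n → ℝ) :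
    Qmat A b x = wsum A (fun i => lev A b x i / (A i ⬝ᵥ x - b i) ^ 2) := rfl

/-- Derivative of `Hmat` in the direction `v`. -/
noncomputable def H1 {m n : ℕ} (A : Matrix (Fin m) (Fin n) ℝ) (b : Fin m → ℝ)
    (v x : Fin n → ℝ) : Matrix (Fin n) (Fin n) ℝ :=
  wsum A (fun i => -2 * (A i ⬝ᵥ v) / (A i ⬝ᵥ x - b i) ^ 3)

/-- Second derivative of `Hmat` in the direction `v`. -/
noncomputable def H2 {m n : ℕ} (A : Matrix (Fin m) (Fin n) ℝ) (b : Fin m → ℝ)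
    (v x : Fin n → ℝ) : Matrix (Fin n) (Fin n) ℝ :=
  wsum A (fun i => 6 * (A i ⬝ᵥ v) ^ 2 / (A i ⬝ᵥ x - b i) ^ 4)

lemma hasDerivAt_slack {n : ℕ} (a : Fin n → ℝ) (β : ℝ) (x v : Fin n → ℝ) :
    HasDerivAt (fun t : ℝ => a ⬝ᵥ (x + t • v) - β) (a ⬝ᵥ v) 0 := by
  have : (fun t : ℝ => a ⬝ᵥ (x + t • v) - β) = fun t => t * (a ⬝ᵥ v) + (a ⬝ᵥ x - β) := by
    funext t
    rw [dotProduct_add, dotProduct_smul, smul_eq_mul]; ring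
  rw [this]
  simpa using ((hasDerivAt_id (0 : ℝ)).mul_const (a ⬝ᵥ v)).add_const (a ⬝ᵥ x - β)

lemma hasDerivAt_Hmat {m n : ℕ} (A : Matrix (Fin m) (Fin n) ℝ) (b : Fin m → ℝ)
    (x v : Fin n → ℝ) (hx : ∀ i, A i ⬝ᵥ x > b i) :
    HasDerivAt (fun t : ℝ => Hmat A b (x + t • v)) (H1 A b v x) 0 := by
  simp only [Hmat_eq]
  apply hasDerivAt_wsum
  intro i
  have hs : A i ⬝ᵥ x - b i ≠ 0 := (sub_pos.2 (hx i)).ne'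
  have h := ((hasDerivAt_slack (A i) (b i) x v).fun_pow 2).fun_inv (by simpa using hs)
  refine h.congr_deriv ?_
  simp
  field_simp

lemma hasDerivAt_H1 {m n : ℕ} (A : Matrix (Fin m) (Fin n) ℝ) (b : Fin m → ℝ)
    (x v : Fin n → ℝ) (hx : ∀ i, A i ⬝ᵥ x > b i) :
    HasDerivAt (fun t : ℝ => H1 A b v (x + t • v)) (H2 A b v x) 0 := by
  simp only [H1]
  apply hasDerivAt_wsum
  intro i
  have hs : A i ⬝ᵥ x - b i ≠ 0 := (sub_pos.2 (hx i)).ne'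
  have h := (((hasDerivAt_slack (A i) (b i) x v).fun_pow 3).fun_inv (by simpa using hs)).const_mul
    (-2 * (A i ⬝ᵥ v))
  refine h.congr_deriv ?_
  simp
  field_simp
  ring

lemma Hmat_posDef {m n : ℕ} (A : Matrix (Fin m) (Fin n) ℝ) (hrank : A.rank = n) (b : Fin m → ℝ)
    (x : Fin n → ℝ) (hx : ∀ i, A i ⬝ᵥ x > b i) : (Hmat A b x).PosDef := by
  rw [Hmat_eq]
  refine wsum_posDef A hrank _ fun i => ?_
  have : 0 < A i ⬝ᵥ x - b i := sub_pos.2 (hx i)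
  positivity

lemma contDiffAt_Fvol {m n : ℕ} (A : Matrix (Fin m) (Fin n) ℝ) (hrank : A.rank = n)
    (b : Fin m → ℝ) (x : Fin n → ℝ) (hx : ∀ i, A i ⬝ᵥ x > b i) :
    ContDiffAt ℝ 2 (Fvol A b) x := by
  have hdot : ∀ i, ContDiff ℝ 2 (fun y : Fin n → ℝ => A i ⬝ᵥ y) := fun i => by
    unfold dotProduct
    fun_prop
  have hH : ContDiffAt ℝ 2 (Hmat A b) x := by
    unfold Hmat
    refine ContDiffAt.sum fun i _ => ?_
    have hs : A i ⬝ᵥ x - b i ≠ 0 := (sub_pos.2 (hx i)).ne'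
    have hc : ContDiffAt ℝ 2 (fun y : Fin n → ℝ => ((A i ⬝ᵥ y - b i) ^ 2)⁻¹) x :=
      ContDiffAt.inv (((hdot i).contDiffAt.sub contDiffAt_const).pow 2) (pow_ne_zero 2 hs)
    exact hc.smul (contDiffAt_const (c := Matrix.vecMulVec (A i) (A i)))
  unfold Fvol
  have hdet : ContDiffAt ℝ 2 (fun y => (Hmat A b y).det) x :=
    ((contDiff_det_aux (k := 2)).contDiffAt (x := Hmat A b x)).comp x hH
  exact contDiffAt_const.mul (hdet.log (Hmat_posDef A hrank b x hx).det_pos.ne')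

lemma isOpen_int {m n : ℕ} (A : Matrix (Fin m) (Fin n) ℝ) (b : Fin m → ℝ) :
    IsOpen {x : Fin n → ℝ | ∀ i, A i ⬝ᵥ x > b i} := by
  simp only [Set.ofPred_forall]
  refine isOpen_iInter_of_finite fun i => ?_
  refine isOpen_lt continuous_const ?_
  unfold dotProduct
  fun_prop

lemma hasDerivAt_line {n : ℕ} (x v : Fin n → ℝ) : HasDerivAt (fun t : ℝ => x + t • v) v 0 := by
  simpa using ((hasDerivAt_id (0 : ℝ)).smul_const v).const_add x

lemma fderiv_Fvol {m n : ℕ} (A : Matrix (Fin m) (Fin n) ℝ) (hrank : A.rank = n)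
    (b : Fin m → ℝ) (x v : Fin n → ℝ) (hx : ∀ i, A i ⬝ᵥ x > b i) :
    fderiv ℝ (Fvol A b) x v = (1 / 2) * ((Hmat A b x)⁻¹ * H1 A b v x).trace := by
  have hd : HasFDerivAt (Fvol A b) (fderiv ℝ (Fvol A b) x) (x + (0 : ℝ) • v) := by
    simpa using ((contDiffAt_Fvol A hrank b x hx).differentiableAt (by simp)).hasFDerivAt
  have h1 := hd.comp_hasDerivAt (0 : ℝ) (hasDerivAt_line x v)
  have h2 := hasDerivAt_logdet _ _ 0 (hasDerivAt_Hmat A b x v hx)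
    (by simpa using (Hmat_posDef A hrank b x hx).det_pos.ne')
  have := h1.unique h2
  simpa using this

lemma second_Fvol {m n : ℕ} (A : Matrix (Fin m) (Fin n) ℝ) (hrank : A.rank = n)
    (b : Fin m → ℝ) (x v : Fin n → ℝ) (hx : ∀ i, A i ⬝ᵥ x > b i) :
    iteratedFDeriv ℝ 2 (Fvol A b) x ![v, v] =
      (1 / 2) * (((Hmat A b x)⁻¹ * H2 A b v x).trace -
        ((Hmat A b x)⁻¹ * H1 A b v x * (Hmat A b x)⁻¹ * H1 A b v x).trace) := by
  rw [iteratedFDeriv_two_apply]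
  simp only [Matrix.cons_val_zero, Matrix.cons_val_one]
  have hc : ContDiffAt ℝ 1 (fderiv ℝ (Fvol A b)) x :=
    (contDiffAt_Fvol A hrank b x hx).fderiv_right (by norm_num)
  have hd : HasFDerivAt (fderiv ℝ (Fvol A b)) (fderiv ℝ (fderiv ℝ (Fvol A b)) x)
      (x + (0 : ℝ) • v) := by
    simpa using (hc.differentiableAt (by simp)).hasFDerivAt
  have h0 : HasDerivAt (fun t : ℝ => fderiv ℝ (Fvol A b) (x + t • v))
      (fderiv ℝ (fderiv ℝ (Fvol A b)) x v) 0 :=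
    hd.comp_hasDerivAt (0 : ℝ) (hasDerivAt_line x v)
  have h1 : HasDerivAt (fun t : ℝ => fderiv ℝ (Fvol A b) (x + t • v) v)
      (fderiv ℝ (fderiv ℝ (Fvol A b)) x v v) 0 :=
    (ContinuousLinearMap.apply ℝ ℝ v).hasFDerivAt.comp_hasDerivAt (0 : ℝ) h0
  have hz : x + (0 : ℝ) • v = x := by simp
  have h2 := hasDerivAt_half_trace (fun t : ℝ => Hmat A b (x + t • v))
    (fun t : ℝ => H1 A b v (x + t • v)) _ _ 0 (hasDerivAt_Hmat A b x v hx)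
    (hasDerivAt_H1 A b x v hx)
    (by rw [hz]; exact (Hmat_posDef A hrank b x hx).det_pos.ne')
  simp only [hz] at h2
  have hev : ∀ᶠ t : ℝ in nhds 0, ∀ i, A i ⬝ᵥ (x + t • v) > b i := by
    have hcont := (hasDerivAt_line x v).continuousAt
    refine hcont.eventually_mem ((isOpen_int A b).mem_nhds ?_)
    simpa using hx
  have h3 := h2.congr_of_eventuallyEq (f₁ := fun t : ℝ => fderiv ℝ (Fvol A b) (x + t • v) v)
    (by filter_upwards [hev] with t ht using fderiv_Fvol A hrank b _ v ht)
  exact h1.unique h3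

lemma final_alg {m : ℕ} (P : Fin m → Fin m → ℝ) (σ r : Fin m → ℝ) (hs : ∀ i j, P i j = P j i)
    (hP : ∀ i, ∑ j, P i j ^ 2 = σ i) :
    |∑ i, ∑ j, P i j ^ 2 * (r i * r j)| ≤ ∑ i, σ i * r i ^ 2 := by
  have e1 : ∑ i, ∑ j, P i j ^ 2 * r i ^ 2 = ∑ i, σ i * r i ^ 2 := by
    refine Finset.sum_congr rfl fun i _ => ?_
    rw [← Finset.sum_mul, hP]
  have e2 : ∑ i, ∑ j, P i j ^ 2 * r j ^ 2 = ∑ i, σ i * r i ^ 2 := by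
    rw [Finset.sum_comm, ← e1]
    refine Finset.sum_congr rfl fun i _ => Finset.sum_congr rfl fun j _ => ?_
    rw [hs]
  have e3 : ∑ i, σ i * r i ^ 2 = ∑ i, ∑ j, P i j ^ 2 * ((r i ^ 2 + r j ^ 2) / 2) := by
    have : ∑ i, ∑ j, P i j ^ 2 * ((r i ^ 2 + r j ^ 2) / 2) =
        (∑ i, ∑ j, P i j ^ 2 * r i ^ 2 + ∑ i, ∑ j, P i j ^ 2 * r j ^ 2) / 2 := by
      simp only [← Finset.sum_add_distrib, Finset.sum_div]
      refine Finset.sum_congr rfl fun i _ => Finset.sum_congr rfl fun j _ => ?_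
      ring
    rw [this, e1, e2]; ring
  rw [e3, abs_le, ← Finset.sum_neg_distrib]
  constructor
  · refine Finset.sum_le_sum fun i _ => ?_
    rw [← Finset.sum_neg_distrib]
    refine Finset.sum_le_sum fun j _ => ?_
    nlinarith [mul_nonneg (sq_nonneg (P i j)) (sq_nonneg (r i + r j))]
  · refine Finset.sum_le_sum fun i _ => Finset.sum_le_sum fun j _ => ?_
    nlinarith [mul_nonneg (sq_nonneg (P i j)) (sq_nonneg (r i - r j))]

lemma bounds_aux {m n : ℕ} (A : Matrix (Fin m) (Fin n) ℝ) (hrank : A.rank = n)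
    (b : Fin m → ℝ) (x v : Fin n → ℝ) (hx : ∀ i, A i ⬝ᵥ x > b i) :
    v ⬝ᵥ (Qmat A b x) *ᵥ v ≤ iteratedFDeriv ℝ 2 (Fvol A b) x ![v, v] ∧
      iteratedFDeriv ℝ 2 (Fvol A b) x ![v, v] ≤ 5 * (v ⬝ᵥ (Qmat A b x) *ᵥ v) := by
  rw [second_Fvol A hrank b x v hx]
  have hpd := Hmat_posDef A hrank b x hx
  have hdet : IsUnit (Hmat A b x).det := isUnit_iff_ne_zero.2 hpd.det_pos.ne'
  have hs : ∀ i, A i ⬝ᵥ x - b i ≠ 0 := fun i => (sub_pos.2 (hx i)).ne'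
  set G := (Hmat A b x)⁻¹ with hG
  have hGs : Gᵀ = G := by
    rw [hG, Matrix.transpose_nonsing_inv, Hmat_eq, wsum_isSymm]
  have hGsym : ∀ u w : Fin n → ℝ, u ⬝ᵥ (G *ᵥ w) = w ⬝ᵥ (G *ᵥ u) := fun u w => by
    rw [Matrix.dotProduct_mulVec, ← Matrix.mulVec_transpose, hGs, dotProduct_comm]
  set s : Fin m → ℝ := fun i => A i ⬝ᵥ x - b i with hsdef
  set r : Fin m → ℝ := fun i => (A i ⬝ᵥ v) / s i with hr
  set P : Fin m → Fin m → ℝ := fun i j => (A i ⬝ᵥ (G *ᵥ A j)) / (s i * s j) with hPdef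
  have hPs : ∀ i j, P i j = P j i := fun i j => by
    simp only [hPdef]
    rw [hGsym, mul_comm (s i)]
  have hσ : ∀ i, lev A b x i = P i i := fun i => by
    simp only [hPdef, lev, hsdef, ← hG, sq]
  have hPP : ∀ i, ∑ j, P i j ^ 2 = lev A b x i := fun i => by
    have h1 : G * Hmat A b x * G = G := by
      rw [hG, Matrix.nonsing_inv_mul _ hdet, one_mul]
    have h2 : A i ⬝ᵥ (G *ᵥ A i) = (G *ᵥ A i) ⬝ᵥ (Hmat A b x *ᵥ (G *ᵥ A i)) := by
      conv_lhs => rw [← h1]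
      rw [← Matrix.mulVec_mulVec, ← Matrix.mulVec_mulVec, Matrix.dotProduct_mulVec,
        ← Matrix.mulVec_transpose, hGs]
    rw [Hmat_eq, wsum_quad] at h2
    unfold lev
    rw [← hG, h2, Finset.sum_div]
    refine Finset.sum_congr rfl fun j _ => ?_
    simp only [hPdef]
    rw [hGsym (A i) (A j)]
    have := hs i
    have := hs j
    simp only [hsdef]
    field_simp
  have hQ : v ⬝ᵥ (Qmat A b x) *ᵥ v = ∑ i, lev A b x i * r i ^ 2 := by
    rw [Qmat_eq, wsum_quad]
    refine Finset.sum_congr rfl fun i _ => ?_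
    have := hs i
    simp only [hr, hsdef]
    field_simp
  have hT2 : (G * H2 A b v x).trace = 6 * ∑ i, lev A b x i * r i ^ 2 := by
    rw [H2, wsum_trace, Finset.mul_sum]
    refine Finset.sum_congr rfl fun i _ => ?_
    have := hs i
    simp only [hσ, hPdef, hr, hsdef]
    field_simp
  have hT1 : (G * H1 A b v x * G * H1 A b v x).trace =
      4 * ∑ i, ∑ j, P i j ^ 2 * (r i * r j) := by
    conv_lhs => rw [H1, wsum_trace]
    rw [Finset.mul_sum]
    refine Finset.sum_congr rfl fun i _ => ?_
    have h3 : A i ⬝ᵥ ((G * H1 A b v x * G) *ᵥ A i) =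
        (G *ᵥ A i) ⬝ᵥ (H1 A b v x *ᵥ (G *ᵥ A i)) := by
      rw [← Matrix.mulVec_mulVec, ← Matrix.mulVec_mulVec, Matrix.dotProduct_mulVec,
        ← Matrix.mulVec_transpose, hGs]
    rw [H1, wsum_quad] at h3
    rw [h3, Finset.mul_sum, Finset.mul_sum]
    refine Finset.sum_congr rfl fun j _ => ?_
    simp only [hPdef, hr]
    rw [hGsym (A i) (A j)]
    have := hs i
    have := hs j
    simp only [hsdef]
    field_simp
    ring
  have hfin := abs_le.1 (final_alg P (lev A b x) r hPs hPP)
  rw [hQ, hT2, hT1]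
  constructor <;> linarith [hfin.1, hfin.2]

end VolAux

/-- For a bounded full-dimensional polytope `{x | Ax ≥ b}` with nonempty interior, the
volumetric function `F` is `C²` on the interior, and its Hessian satisfies
`Q(x) ⪯ ∇²F(x) ⪯ 5 Q(x)` at every interior point `x`. -/
theorem volumetric_hessian_Q_bounds {m n : ℕ} (A : Matrix (Fin m) (Fin n) ℝ)
    (b : Fin m → ℝ) (hrank : A.rank = n)
    (hbd : Bornology.IsBounded {x : Fin n → ℝ | ∀ i, A i ⬝ᵥ x ≥ b i})
    (hne : ∃ x : Fin n → ℝ, ∀ i, A i ⬝ᵥ x > b i) :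
    ContDiffOn ℝ 2 (Fvol A b) {x : Fin n → ℝ | ∀ i, A i ⬝ᵥ x > b i} ∧
    ∀ x : Fin n → ℝ, (∀ i, A i ⬝ᵥ x > b i) → ∀ v : Fin n → ℝ,
      v ⬝ᵥ (Qmat A b x) *ᵥ v ≤ iteratedFDeriv ℝ 2 (Fvol A b) x ![v, v] ∧
      iteratedFDeriv ℝ 2 (Fvol A b) x ![v, v] ≤ 5 * (v ⬝ᵥ (Qmat A b x) *ᵥ v) := by
  exact ⟨fun x hx => (contDiffAt_Fvol A hrank b x hx).contDiffWithinAt,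
    fun x hx v => bounds_aux A hrank b x v hx⟩
end

section
/- Let K = {x ∈ ℝ^n : Ax ≥ b} be a bounded polytope with nonempty interior and m constraints, let F(x) = (1/2) ln det H(x), and let vc(K) be the volumetric center of K (the minimizer of F over the interior of K). Then K ⊆ mn · E(vc(K), ∇²F(vc(K))); that is, every y ∈ K satisfies D²F(vc(K))[y − vc(K), y − vc(K)] ≤ m² n², where D²F(vc(K)) is the second derivative (Hessian) of F at vc(K). -/
open Matrix

lemma vc_inj {m n : ℕ} (A : Matrix (Fin m) (Fin n) ℝ) (b : Fin m → ℝ)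
    (hbd : Bornology.IsBounded {x : Fin n → ℝ | ∀ i, A i ⬝ᵥ x ≥ b i})
    (vc : Fin n → ℝ) (hvc : ∀ i, A i ⬝ᵥ vc > b i) (v : Fin n → ℝ)
    (hv : ∀ i, A i ⬝ᵥ v = 0) : v = 0 := by
  obtain ⟨R, hR⟩ := hbd.exists_norm_le
  by_contra hne
  have hpos : 0 < ‖v‖ := norm_pos_iff.2 hne
  have h1 := hR (vc + ((R + ‖vc‖ + 1) / ‖v‖) • v) (fun i => by
    simp only [dotProduct_add, dotProduct_smul, hv i, smul_zero, add_zero]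
    exact (hvc i).le)
  have hR0 : 0 ≤ R := (norm_nonneg _).trans h1
  have h2 : ‖((R + ‖vc‖ + 1) / ‖v‖) • v‖ = R + ‖vc‖ + 1 := by
    rw [norm_smul, Real.norm_of_nonneg (by positivity)]
    field_simp
  have h3 := norm_sub_le (vc + ((R + ‖vc‖ + 1) / ‖v‖) • v) vc
  rw [add_sub_cancel_left, h2] at h3
  linarith

lemma vc_quad {m n : ℕ} (c : Fin m → ℝ) (w : Fin m → Fin n → ℝ) (x : Fin n → ℝ) :
    x ⬝ᵥ ((∑ i, c i • vecMulVec (w i) (w i)) *ᵥ x) = ∑ i, c i * (w i ⬝ᵥ x) ^ 2 := by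
  rw [Matrix.sum_mulVec, dotProduct_sum]
  refine Finset.sum_congr rfl fun i _ => ?_
  rw [smul_mulVec, vecMulVec_mulVec, dotProduct_smul]
  rw [dotProduct_smul, dotProduct_comm x (w i)]
  simp only [smul_eq_mul, MulOpposite.smul_eq_mul_unop, MulOpposite.unop_op]
  ring

lemma vc_herm {m n : ℕ} (c : Fin m → ℝ) (w : Fin m → Fin n → ℝ) :
    (∑ i, c i • vecMulVec (w i) (w i)).IsHermitian := by
  unfold Matrix.IsHermitian
  ext i j
  simp [Matrix.sum_apply, vecMulVec_apply, mul_comm]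

lemma vc_posDef {m n : ℕ} (A : Matrix (Fin m) (Fin n) ℝ) (b : Fin m → ℝ)
    (hinj : ∀ v : Fin n → ℝ, (∀ i, A i ⬝ᵥ v = 0) → v = 0)
    (x : Fin n → ℝ) (hx : ∀ i, A i ⬝ᵥ x > b i) : (Hmat A b x).PosDef := by
  refine .of_dotProduct_mulVec_pos (vc_herm _ _) fun v hv => ?_
  have : star v = v := by simp
  rw [this, Hmat, vc_quad _ (fun i => A i)]
  have hc : ∀ i, 0 < ((A i ⬝ᵥ x - b i) ^ 2)⁻¹ := fun i => by
    have := sub_pos.2 (hx i)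
    positivity
  have hnn : ∀ i ∈ Finset.univ, 0 ≤ ((A i ⬝ᵥ x - b i) ^ 2)⁻¹ * (A i ⬝ᵥ v) ^ 2 := fun i _ =>
    mul_nonneg (hc i).le (sq_nonneg _)
  refine lt_of_le_of_ne (Finset.sum_nonneg hnn) fun h => hv (hinj v fun i => ?_)
  have := (Finset.sum_eq_zero_iff_of_nonneg hnn).1 h.symm i (Finset.mem_univ i)
  rcases mul_eq_zero.1 this with h | h
  · exact absurd h (hc i).ne'
  · exact pow_eq_zero_iff (two_ne_zero) |>.1 h

lemma vc_logdet {n : ℕ} (M : Matrix (Fin n) (Fin n) ℝ) (hM : M.PosDef) :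
    Real.log M.det ≤ M.trace - n := by
  rw [hM.1.det_eq_prod_eigenvalues, hM.1.trace_eq_sum_eigenvalues]
  simp only [RCLike.ofReal_real_eq_id, id]
  rw [Real.log_prod (fun i _ => (hM.eigenvalues_pos i).ne')]
  calc _ ≤ ∑ i, (hM.1.eigenvalues i - 1) :=
        Finset.sum_le_sum fun i _ => Real.log_le_sub_one_of_pos (hM.eigenvalues_pos i)
    _ = _ := by simp

open scoped MatrixOrder in
lemma vc_sqrt {n : ℕ} (M : Matrix (Fin n) (Fin n) ℝ) (hM : M.PosDef) :
    ∃ U V : Matrix (Fin n) (Fin n) ℝ, M = Uᵀ * U ∧ V * U = 1 ∧ U * V = 1 := by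
  obtain ⟨U, hU⟩ := CStarAlgebra.nonneg_iff_eq_star_mul_self.mp hM.posSemidef.nonneg
  have hd : IsUnit U.det := by
    have := hM.det_pos
    rw [hU, det_mul] at this
    exact isUnit_iff_ne_zero.2 (right_ne_zero_of_mul this.ne')
  refine ⟨U, U⁻¹, ?_, nonsing_inv_mul _ hd, mul_nonsing_inv _ hd⟩
  rw [hU, star_eq_conjTranspose, conjTranspose_eq_transpose_of_trivial]

lemma vc_leverage {m n : ℕ} (A : Matrix (Fin m) (Fin n) ℝ) (b : Fin m → ℝ)
    (hinj : ∀ v : Fin n → ℝ, (∀ i, A i ⬝ᵥ v = 0) → v = 0)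
    (vc : Fin n → ℝ) (hvc : ∀ i, A i ⬝ᵥ vc > b i) :
    ∃ σ : Fin m → ℝ, (∀ i, 0 ≤ σ i) ∧ (∀ i, σ i ≤ 1) ∧ ∑ i, σ i = n ∧
      (∀ h : Fin n → ℝ, ∀ i, (A i ⬝ᵥ h / (A i ⬝ᵥ vc - b i)) ^ 2 ≤
        σ i * ∑ j, (A j ⬝ᵥ h / (A j ⬝ᵥ vc - b j)) ^ 2) ∧
      ∀ x : Fin n → ℝ, (∀ i, A i ⬝ᵥ x > b i) → Fvol A b x ≤ Fvol A b vc +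
        (1 / 2) * (∑ i, σ i * ((A i ⬝ᵥ vc - b i) / (A i ⬝ᵥ x - b i)) ^ 2 - n) := by
  have hpd := vc_posDef A b hinj
  obtain ⟨U, V, hU, hVU, hUV⟩ := vc_sqrt _ (hpd vc hvc)
  set w : Fin m → Fin n → ℝ := fun i => A i ᵥ* V with hw
  have hs : ∀ i, 0 < A i ⬝ᵥ vc - b i := fun i => sub_pos.2 (hvc i)
  have hM : ∀ x, Vᵀ * Hmat A b x * V =
      ∑ i, ((A i ⬝ᵥ x - b i) ^ 2)⁻¹ • vecMulVec (w i) (w i) := by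
    intro x
    rw [Hmat, Matrix.mul_sum, Matrix.sum_mul]
    refine Finset.sum_congr rfl fun i _ => ?_
    rw [Matrix.mul_smul, Matrix.smul_mul, mul_vecMulVec, vecMulVec_mul, mulVec_transpose]
  have hM0 : Vᵀ * Hmat A b vc * V = 1 := by
    rw [hU, ← Matrix.mul_assoc, ← transpose_mul, hUV, Matrix.mul_assoc, hUV]
    simp
  have htr : ∀ x, (Vᵀ * Hmat A b x * V).trace =
      ∑ i, ((A i ⬝ᵥ x - b i) ^ 2)⁻¹ * (w i ⬝ᵥ w i) := by
    intro x
    rw [hM, trace_sum]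
    simp [trace_smul, trace_vecMulVec]
  have hww : ∀ i, 0 ≤ w i ⬝ᵥ w i := fun i => by
    simpa using dotProduct_star_self_nonneg (w i)
  refine ⟨fun i => ((A i ⬝ᵥ vc - b i) ^ 2)⁻¹ * (w i ⬝ᵥ w i), ?_, ?_, ?_, ?_, ?_⟩
  · intro i
    exact mul_nonneg (by positivity) (hww i)
  · intro i
    have h1 : w i ⬝ᵥ w i = ∑ j, ((A j ⬝ᵥ vc - b j) ^ 2)⁻¹ * (w j ⬝ᵥ w i) ^ 2 := by
      rw [← vc_quad, ← hM, hM0, one_mulVec]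
    have h2 : ((A i ⬝ᵥ vc - b i) ^ 2)⁻¹ * (w i ⬝ᵥ w i) ^ 2 ≤ w i ⬝ᵥ w i := by
      conv_rhs => rw [h1]
      exact Finset.single_le_sum (f := fun j => ((A j ⬝ᵥ vc - b j) ^ 2)⁻¹ * (w j ⬝ᵥ w i) ^ 2)
        (fun j _ => by positivity) (Finset.mem_univ i)
    rcases (hww i).eq_or_lt with h | h
    · simp [← h]
    · by_contra hc
      push Not at hc
      nlinarith
  · rw [← htr, hM0]; simp
  · intro h i
    have e1 : ∀ j, A j ⬝ᵥ h = w j ⬝ᵥ (U *ᵥ h) := by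
      intro j
      rw [hw, ← dotProduct_mulVec, mulVec_mulVec, hVU, one_mulVec]
    have e2 : ∑ j, (A j ⬝ᵥ h / (A j ⬝ᵥ vc - b j)) ^ 2 = (U *ᵥ h) ⬝ᵥ (U *ᵥ h) := by
      have : (U *ᵥ h) ⬝ᵥ (U *ᵥ h) = h ⬝ᵥ (Hmat A b vc *ᵥ h) := by
        rw [hU, ← mulVec_mulVec, dotProduct_mulVec h, vecMul_transpose]
      rw [this, Hmat, vc_quad _ (fun i => A i)]
      refine Finset.sum_congr rfl fun j _ => ?_
      rw [div_pow, div_eq_inv_mul]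
    rw [e2, div_pow, div_eq_inv_mul, mul_assoc, e1]
    refine mul_le_mul_of_nonneg_left ?_ (by positivity)
    have := Finset.sum_mul_sq_le_sq_mul_sq Finset.univ (w i) (U *ᵥ h)
    simpa [dotProduct, sq] using this
  · intro x hx
    have hMx : (Vᵀ * Hmat A b x * V).PosDef := by
      have := (hpd x hx).conjTranspose_mul_mul_same (B := V) (by
        intro p q hpq
        have := congrArg (fun z => U *ᵥ z) hpq
        simpa [mulVec_mulVec, hUV] using this)
      simpa [conjTranspose_eq_transpose_of_trivial] using this
    have h1 := vc_logdet _ hMx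
    rw [htr] at h1
    have hd0 : Vᵀ.det * (Hmat A b vc).det * V.det = 1 := by
      rw [← det_mul, ← det_mul, hM0, det_one]
    have hp0 := (hpd vc hvc).det_pos
    have hp := (hpd x hx).det_pos
    have h2 : (Hmat A b x).det = (Vᵀ * Hmat A b x * V).det * (Hmat A b vc).det := by
      rw [det_mul, det_mul]
      linear_combination (-(Hmat A b x).det) * hd0
    have h3 : ∑ i, ((A i ⬝ᵥ vc - b i) ^ 2)⁻¹ * (w i ⬝ᵥ w i) *
        ((A i ⬝ᵥ vc - b i) / (A i ⬝ᵥ x - b i)) ^ 2 =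
        ∑ i, ((A i ⬝ᵥ x - b i) ^ 2)⁻¹ * (w i ⬝ᵥ w i) := by
      refine Finset.sum_congr rfl fun i _ => ?_
      have := (hs i).ne'
      have := (sub_pos.2 (hx i)).ne'
      field_simp
    rw [h3, Fvol, Fvol, h2, Real.log_mul hMx.det_pos.ne' hp0.ne']
    linarith

lemma vc_second (g u : ℝ → ℝ) (hg : ContDiffAt ℝ 2 g 0) (hu : ContDiffAt ℝ 2 u 0)
    (h0 : g 0 = u 0) (hle : ∀ᶠ τ in nhds 0, g τ ≤ u τ) (hmin : IsLocalMin g 0) :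
    deriv u 0 = 0 ∧ deriv (deriv g) 0 ≤ deriv (deriv u) 0 := by
  have humin : IsLocalMin u 0 := by
    filter_upwards [hle, hmin] with τ h1 h2
    rw [← h0]; exact h2.trans h1
  refine ⟨humin.deriv_eq_zero, ?_⟩
  have dd : ∀ f : ℝ → ℝ, ContDiffAt ℝ 2 f 0 → DifferentiableAt ℝ (deriv f) 0 ∧
      ∀ᶠ τ in nhds 0, DifferentiableAt ℝ f τ := by
    intro f hf
    refine ⟨?_, ?_⟩
    · have : ContDiffAt ℝ 1 (deriv f) 0 := by
        exact hf.derivWithin (by norm_num)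
      exact this.differentiableAt (by simp)
    · filter_upwards [hf.eventually (by simp)] with τ hτ
      exact hτ.differentiableAt (by simp)
  have hd1 : deriv (fun τ => u τ - g τ) =ᶠ[nhds 0] fun τ => deriv u τ - deriv g τ := by
    filter_upwards [(dd g hg).2, (dd u hu).2] with τ h1 h2
    exact deriv_sub h2 h1
  have hd2 : deriv (deriv (fun τ => u τ - g τ)) 0 = deriv (deriv u) 0 - deriv (deriv g) 0 := by
    rw [hd1.deriv_eq]
    exact deriv_sub (dd u hu).1 (dd g hg).1
  by_contra hc
  push Not at hc
  have hmax : IsLocalMax (fun τ => u τ - g τ) 0 := by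
    refine isLocalMax_of_deriv_deriv_neg (by rw [hd2]; linarith) ?_
      (hu.continuousAt.sub hg.continuousAt)
    rw [hd1.self_of_nhds]
    simp only
    rw [humin.deriv_eq_zero, hmin.deriv_eq_zero, sub_zero]
  have hz : (fun τ => u τ - g τ) =ᶠ[nhds 0] fun _ => (0 : ℝ) := by
    filter_upwards [hmax, hle] with τ h1 h2
    simp only [h0, sub_self] at h1
    linarith
  have := hz.deriv.deriv_eq
  rw [hd2] at this
  simp at this
  linarith

lemma vc_line {n : ℕ} (F : (Fin n → ℝ) → ℝ) (x h : Fin n → ℝ) (hF : ContDiffAt ℝ 2 F x) :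
    iteratedFDeriv ℝ 2 F x ![h, h] = deriv (deriv (fun τ : ℝ => F (x + τ • h))) 0 := by
  rw [iteratedFDeriv_two_apply]
  have hl : ∀ τ : ℝ, HasDerivAt (fun τ : ℝ => x + τ • h) h τ := fun τ => by
    simpa using ((hasDerivAt_id τ).smul_const h).const_add x
  have hcont : Filter.Tendsto (fun τ : ℝ => x + τ • h) (nhds 0) (nhds x) := by
    have := (hl 0).continuousAt.tendsto
    simpa using this
  have h1 : deriv (fun τ : ℝ => F (x + τ • h)) =ᶠ[nhds 0] fun τ => fderiv ℝ F (x + τ • h) h := by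
    filter_upwards [hcont.eventually (hF.eventually (by simp))] with τ hτ
    exact ((hτ.differentiableAt (by simp)).hasFDerivAt.comp_hasDerivAt τ (hl τ)).deriv
  rw [h1.deriv_eq]
  have h2 : DifferentiableAt ℝ (fderiv ℝ F) (x + (0 : ℝ) • h) := by
    rw [zero_smul, add_zero]
    exact (hF.fderiv_right (m := 1) (by norm_num)).differentiableAt (by simp)
  have h3 : HasDerivAt (fun τ : ℝ => fderiv ℝ F (x + τ • h))
      (fderiv ℝ (fderiv ℝ F) (x + (0 : ℝ) • h) h) 0 :=
    h2.hasFDerivAt.comp_hasDerivAt (0:ℝ) (hl 0)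
  have h4 : HasDerivAt (fun τ : ℝ => fderiv ℝ F (x + τ • h) h)
      (fderiv ℝ (fderiv ℝ F) (x + (0 : ℝ) • h) h h) 0 :=
    (ContinuousLinearMap.apply ℝ ℝ h).hasFDerivAt.comp_hasDerivAt (0:ℝ) h3
  rw [h4.deriv, zero_smul, add_zero]
  rfl

lemma vc_smooth {m n : ℕ} (A : Matrix (Fin m) (Fin n) ℝ) (b : Fin m → ℝ)
    (x : Fin n → ℝ) (hx : ∀ i, A i ⬝ᵥ x > b i) (hd : (Hmat A b x).det ≠ 0) :
    ContDiffAt ℝ 2 (Fvol A b) x := by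
  unfold Fvol
  refine contDiffAt_const.mul (ContDiffAt.log ?_ hd)
  simp only [det_apply, Hmat, Matrix.sum_apply, Matrix.smul_apply, smul_eq_mul, vecMulVec_apply]
  refine ContDiffAt.sum fun p _ => ContDiffAt.const_smul _ ?_
  refine contDiffAt_prod fun i _ => ?_
  refine ContDiffAt.sum fun k _ => ContDiffAt.mul (ContDiffAt.inv ?_ ?_) contDiffAt_const
  · simp only [dotProduct]
    fun_prop
  · have := (sub_pos.2 (hx k)).ne'
    positivity

lemma vc_u {m : ℕ} (σ t : Fin m → ℝ) (c d : ℝ) :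
    let u : ℝ → ℝ := fun τ => c + (1 / 2) * (∑ i, σ i * (1 / (1 + τ * t i)) ^ 2 - d)
    ContDiffAt ℝ 2 u 0 ∧ deriv u 0 = - ∑ i, σ i * t i ∧
      deriv (deriv u) 0 = 3 * ∑ i, σ i * t i ^ 2 := by
  intro u
  have hev : ∀ᶠ τ : ℝ in nhds 0, ∀ i, 1 + τ * t i ≠ 0 := by
    rw [Filter.eventually_all]
    intro i
    have : ContinuousAt (fun τ : ℝ => 1 + τ * t i) 0 := by fun_prop
    exact this.eventually_ne (by simp)
  have hd1 : ∀ τ : ℝ, (∀ i, 1 + τ * t i ≠ 0) →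
      HasDerivAt u (- ∑ i, σ i * t i * (1 / (1 + τ * t i)) ^ 3) τ := by
    intro τ hτ
    have hi : ∀ i ∈ Finset.univ, HasDerivAt (fun τ => σ i * (1 / (1 + τ * t i)) ^ 2)
        (-2 * (σ i * t i * (1 / (1 + τ * t i)) ^ 3)) τ := by
      intro i _
      have hl : HasDerivAt (fun τ : ℝ => 1 + τ * t i) (t i) τ := by
        simpa using ((hasDerivAt_id τ).mul_const (t i)).const_add 1
      have := ((((hasDerivAt_const τ (1:ℝ)).fun_div hl (hτ i)).fun_pow 2).const_mul (σ i))
      refine this.congr_deriv ?_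
      have := hτ i
      rw [show 2 - 1 = 1 from rfl, pow_one]
      push_cast
      field_simp
      ring
    have := (((HasDerivAt.fun_sum hi).sub_const d).const_mul (1 / 2)).const_add c
    refine this.congr_deriv ?_
    rw [← Finset.mul_sum]; ring
  refine ⟨?_, ?_, ?_⟩
  · refine contDiffAt_const.add (contDiffAt_const.mul (ContDiffAt.sub ?_ contDiffAt_const))
    refine ContDiffAt.sum fun i _ => contDiffAt_const.mul (ContDiffAt.pow ?_ 2)
    exact contDiffAt_const.div (by fun_prop) (by simp)
  · rw [(hd1 0 hev.self_of_nhds).deriv]; simp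
  · have he : deriv u =ᶠ[nhds 0] fun τ => - ∑ i, σ i * t i * (1 / (1 + τ * t i)) ^ 3 := by
      filter_upwards [hev] with τ hτ
      exact (hd1 τ hτ).deriv
    rw [he.deriv_eq]
    have hi : ∀ i ∈ Finset.univ, HasDerivAt (fun τ => σ i * t i * (1 / (1 + τ * t i)) ^ 3)
        (-3 * (σ i * t i ^ 2)) (0:ℝ) := by
      intro i _
      have hl : HasDerivAt (fun τ : ℝ => 1 + τ * t i) (t i) 0 := by
        simpa using ((hasDerivAt_id (0:ℝ)).mul_const (t i)).const_add 1
      have := ((((hasDerivAt_const (0:ℝ) (1:ℝ)).fun_div hl (by simp)).fun_pow 3).const_mul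
        (σ i * t i))
      refine this.congr_deriv ?_
      simp
      ring
    rw [(HasDerivAt.fun_sum hi).fun_neg.deriv, ← Finset.mul_sum]; ring

lemma vc_arith {m n : ℕ} (σ t : Fin m → ℝ) (h0 : ∀ i, 0 ≤ σ i) (h1 : ∀ i, σ i ≤ 1)
    (hs : ∑ i, σ i = n) (hCS : ∀ i, t i ^ 2 ≤ σ i * ∑ j, t j ^ 2) (ht : ∀ i, -1 ≤ t i)
    (hz : ∑ i, σ i * t i = 0) : 3 * ∑ i, σ i * t i ^ 2 ≤ (m : ℝ) ^ 2 * (n : ℝ) ^ 2 := by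
  have hnm : n ≤ m := by
    have : (n : ℝ) ≤ m := by
      rw [← hs]
      calc _ ≤ ∑ i : Fin m, (1 : ℝ) := Finset.sum_le_sum fun i _ => h1 i
        _ = m := by simp
    exact_mod_cast this
  rcases Nat.eq_zero_or_pos n with rfl | hn
  · have hσ : ∀ i, σ i = 0 := by
      intro i
      have := (Finset.sum_eq_zero_iff_of_nonneg (fun i _ => h0 i)).1 (by simpa using hs)
      exact this i (Finset.mem_univ i)
    simp [hσ]
  have hm : 0 < m := lt_of_lt_of_le hn hnm
  have hnR : (1 : ℝ) ≤ n := by exact_mod_cast hn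
  have hmR : (1 : ℝ) ≤ m := by exact_mod_cast hm
  have key : ∀ i, σ i * (t i + 1) ≤ n := by
    intro i
    have e : ∑ i, σ i * (t i + 1) = n := by
      simp_rw [mul_add, Finset.sum_add_distrib, hz, mul_one, hs, zero_add]
    rw [← e]
    exact Finset.single_le_sum (f := fun i => σ i * (t i + 1))
      (fun j _ => mul_nonneg (h0 j) (by linarith [ht j])) (Finset.mem_univ i)
  by_cases hm1 : m = 1
  · subst hm1
    have : n = 1 := by omega
    subst this
    simp at hs hz ⊢
    rw [hs] at hz ⊢
    simp at hz
    rw [hz]; norm_num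
  by_cases hmn2 : m = 2 ∧ n = 2
  · obtain ⟨rfl, rfl⟩ := hmn2
    simp [Fin.sum_univ_two] at hs hz ⊢
    have a := h1 0
    have b := h1 1
    have e0 : σ 0 = 1 := by linarith
    have e1 : σ 1 = 1 := by linarith
    rw [e0, e1] at hz ⊢
    have c := ht 0
    have d := ht 1
    have : t 1 = - t 0 := by linarith
    rw [this] at d ⊢
    nlinarith
  have hm2 : 2 ≤ m := by omega
  have hm2R : (2 : ℝ) ≤ m := by exact_mod_cast hm2
  have hub : ∀ i, t i ≤ m * n - 1 := by
    have : Nonempty (Fin m) := ⟨⟨0, hm⟩⟩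
    obtain ⟨k, hk⟩ := Finite.exists_max t
    intro i
    refine (hk i).trans ?_
    rcases le_or_gt (t k) 1 with h | h
    · nlinarith
    have hle : ∑ j, t j ^ 2 ≤ m * t k ^ 2 := by
      calc _ ≤ ∑ j : Fin m, t k ^ 2 := Finset.sum_le_sum fun j _ => by
              nlinarith [hk j, ht j]
        _ = _ := by simp
    have h2 : t k ^ 2 ≤ σ k * (m * t k ^ 2) :=
      (hCS k).trans (mul_le_mul_of_nonneg_left hle (h0 k))
    have h3 : 1 ≤ σ k * m := by
      by_contra hc
      push Not at hc
      have : 0 < t k ^ 2 := by positivity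
      nlinarith
    have h4 := key k
    nlinarith [mul_le_mul_of_nonneg_left h4 (by linarith : (0:ℝ) ≤ m)]
  have hfin : ∑ i, σ i * t i ^ 2 ≤ n * (m * n - 1) := by
    have e : ∑ i, σ i * ((m * n - 2) * t i + (m * n - 1)) = (n : ℝ) * (m * n - 1) := by
      have : ∀ i, σ i * (((m:ℝ) * n - 2) * t i + (m * n - 1))
        = (m * n - 2) * (σ i * t i) + σ i * (m * n - 1) := fun i => by ring
      simp_rw [this, Finset.sum_add_distrib, ← Finset.mul_sum, ← Finset.sum_mul, hz, hs]
      ring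
    rw [← e]
    refine Finset.sum_le_sum fun i _ => mul_le_mul_of_nonneg_left ?_ (h0 i)
    nlinarith [mul_nonneg (by linarith [ht i] : 0 ≤ t i + 1) (by linarith [hub i] : 0 ≤ m * n - 1 - t i)]
  suffices h : 0 ≤ (m : ℝ) ^ 2 * n - 3 * (m * n) + 3 by nlinarith
  rcases Nat.lt_or_ge m 3 with h | h
  · have e2 : m = 2 := by omega
    have e1 : n = 1 := by omega
    subst e2; subst e1; norm_num
  · have : (3 : ℝ) ≤ m := by exact_mod_cast h
    nlinarith [mul_nonneg (mul_nonneg (by linarith : (0:ℝ) ≤ m) (by linarith : (0:ℝ) ≤ n)) (by linarith : (0:ℝ) ≤ m - 3)]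
/-- A bounded polytope `K = {x | Ax ≥ b}` with nonempty interior and volumetric center
`vc(K)` (the minimizer of `F` over the interior) satisfies
`K ⊆ mn · E(vc(K), ∇²F(vc(K)))`: every `y ∈ K` satisfies
`D²F(vc(K))[y - vc(K), y - vc(K)] ≤ m² n²`. -/
theorem polytope_subset_volumetric_hessian_ellipsoid {m n : ℕ}
    (A : Matrix (Fin m) (Fin n) ℝ) (b : Fin m → ℝ)
    (hbd : Bornology.IsBounded {x : Fin n → ℝ | ∀ i, A i ⬝ᵥ x ≥ b i})
    (vc : Fin n → ℝ) (hvc : ∀ i, A i ⬝ᵥ vc > b i)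
    (hmin : ∀ x : Fin n → ℝ, (∀ i, A i ⬝ᵥ x > b i) → Fvol A b vc ≤ Fvol A b x)
    (y : Fin n → ℝ) (hy : ∀ i, A i ⬝ᵥ y ≥ b i) :
    iteratedFDeriv ℝ 2 (Fvol A b) vc ![y - vc, y - vc] ≤ (m : ℝ) ^ 2 * (n : ℝ) ^ 2 := by
  have hinj := vc_inj A b hbd vc hvc
  obtain ⟨σ, h0, h1, hs, hCS, hF⟩ := vc_leverage A b hinj vc hvc
  have hsm := vc_smooth A b vc hvc (vc_posDef A b hinj vc hvc).det_pos.ne'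
  rw [vc_line _ _ _ hsm]
  set h := y - vc with hh
  set t : Fin m → ℝ := fun i => A i ⬝ᵥ h / (A i ⬝ᵥ vc - b i) with ht
  have hpos : ∀ i, 0 < A i ⬝ᵥ vc - b i := fun i => sub_pos.2 (hvc i)
  have hslack : ∀ i, ∀ τ : ℝ, A i ⬝ᵥ (vc + τ • h) - b i =
      (A i ⬝ᵥ vc - b i) * (1 + τ * t i) := by
    intro i τ
    have := (hpos i).ne'
    simp only [ht, dotProduct_add, dotProduct_smul, smul_eq_mul]
    field_simp
    ring
  have hev : ∀ᶠ τ : ℝ in nhds 0, ∀ i, 0 < 1 + τ * t i := by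
    rw [Filter.eventually_all]
    intro i
    have : ContinuousAt (fun τ : ℝ => 1 + τ * t i) 0 := by fun_prop
    exact this.eventually (lt_mem_nhds (by simp))
  have hint : ∀ τ : ℝ, (∀ i, 0 < 1 + τ * t i) → ∀ i, A i ⬝ᵥ (vc + τ • h) > b i := by
    intro τ hτ i
    have := mul_pos (hpos i) (hτ i)
    rw [← hslack] at this
    linarith
  obtain ⟨u1, u2, u3⟩ := vc_u σ t (Fvol A b vc) n
  have hg : ContDiffAt ℝ 2 (fun τ : ℝ => Fvol A b (vc + τ • h)) 0 := by
    refine ContDiffAt.comp (0:ℝ) (g := Fvol A b) (f := fun τ : ℝ => vc + τ • h) ?_ (by fun_prop)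
    simpa using hsm
  obtain ⟨r1, r2⟩ := vc_second _ _ hg u1 (by simp [hs]) (by
    filter_upwards [hev] with τ hτ
    have := hF _ (hint τ hτ)
    refine this.trans (le_of_eq ?_)
    congr 3
    refine Finset.sum_congr rfl fun i _ => ?_
    rw [hslack, div_mul_eq_div_div, div_self (hpos i).ne']) (by
    filter_upwards [hev] with τ hτ
    simpa using hmin _ (hint τ hτ))
  rw [u3] at r2
  rw [u2] at r1
  refine r2.trans (vc_arith σ t h0 h1 hs (hCS h) ?_ (by linarith))
  intro i
  rw [ht, le_div_iff₀ (hpos i), hh, dotProduct_sub]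
  linarith [hy i]
end
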